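/- arXiv:2010.01552 — 6 statements merged into one kernel-verified Lean document; each statement's English description precedes it below -/
import Mathlib

section
/- For every integer d ≥ 1, every probability measure μ on ℝ with μ([−2d, 2d]) = 1 and with ∫ λ^n dμ(λ) = T_n(d) for all integers n ≥ 0 has topological support equal to the full interval [−2d, 2d]. -/
open scoped BigOperators

/-- Points of `ℤ^d`. -/
abbrev Vtx (d : ℕ) := Fin d → ℤ

/-- The `ℓ¹` distance on `ℤ^d`. -/
def dist1 {d : ℕ} (x y : Vtx d) : ℕ := ∑ i, (x i - y i).natAbs

/-- `x : Fin (n+1) → ℤ^d` is a path of length `n` (nearest-neighbour steps). -/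
def IsPath {d n : ℕ} (x : Fin (n + 1) → Vtx d) : Prop :=
  ∀ i : Fin n, dist1 (x i.succ) (x i.castSucc) = 1

/-- The transposition product `(x₀ x₁)∘(x₁ x₂)∘⋯∘(x_{n-1} x_n)`. -/
def transProd {d n : ℕ} (x : Fin (n + 1) → Vtx d) : Equiv.Perm (Vtx d) :=
  ((List.finRange n).map (fun i => Equiv.swap (x i.castSucc) (x i.succ))).prod

/-- The number of paths of length `n` in `ℤ^d`, starting at `x₀`, staying in `B`,
with identity transposition product. -/
noncomputable def numPathsIn (d n : ℕ) (B : Set (Vtx d)) (x₀ : Vtx d) : ℕ :=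
  Nat.card {x : Fin (n + 1) → Vtx d //
    IsPath x ∧ x 0 = x₀ ∧ (∀ i, x i ∈ B) ∧ transProd x = 1}

/-- `T n d`: the number of paths of length `n` in `ℤ^d` starting at the origin whose
transposition product is the identity. -/
noncomputable def T (n d : ℕ) : ℕ := numPathsIn d n Set.univ 0

open MeasureTheory

namespace Umpteen

variable {d : ℕ}

/-- The unit step of `ℤ^d` along coordinate `a.1` with sign `a.2`. -/
def step (a : Fin d × ℤˣ) : Vtx d := Pi.single a.1 (a.2 : ℤ)

theorem step_neg (i : Fin d) (u : ℤˣ) : step (i, -u) = -step (i, u) := by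
  simp [step, Pi.single_neg]

theorem step_injective : Function.Injective (step : Fin d × ℤˣ → Vtx d) := by
  rintro ⟨i, u⟩ ⟨j, v⟩ h
  have hi : i = j := by
    by_contra hij
    have := congrFun h i
    simp [step, hij] at this
  subst hi
  have := congrFun h i
  simp only [step, Pi.single_eq_same] at this
  rw [Units.ext this]

theorem dist1_eq_one_iff {x y : Vtx d} : dist1 y x = 1 ↔ ∃ a, y = x + step a := by
  constructor
  · intro h
    obtain ⟨i, hi⟩ : ∃ i, (y i - x i).natAbs ≠ 0 := by
      by_contra! hc
      simp [dist1, hc] at h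
    have hsum := Finset.add_sum_erase Finset.univ (fun i => (y i - x i).natAbs) (Finset.mem_univ i)
    have hd1 : ∑ i, (y i - x i).natAbs = 1 := h
    have hz : ∑ j ∈ Finset.univ.erase i, (y j - x j).natAbs = 0 := by
      omega
    have hone : (y i - x i).natAbs = 1 := by
      omega
    obtain ⟨u, hu⟩ : IsUnit (y i - x i) := Int.isUnit_iff_natAbs_eq.2 hone
    refine ⟨(i, u), ?_⟩
    ext j
    by_cases hj : j = i
    · subst hj
      simp [step, hu]
    · have := Finset.sum_eq_zero_iff.1 hz j (by simp [hj])
      simp [step, hj]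
      omega
  · rintro ⟨⟨i, u⟩, rfl⟩
    unfold dist1 step
    rw [Finset.sum_eq_single i]
    · simp
    · intro j _ hj
      simp [hj]
    · simp

theorem transProd_succ {n : ℕ} (p : Fin (n + 2) → Vtx d) :
    transProd p = Equiv.swap (p 0) (p 1) * transProd (Fin.tail p) := by
  simp only [transProd, List.finRange_succ, List.map_cons, List.prod_cons, List.map_map]
  rfl

theorem transProd_apply_last {n : ℕ} (p : Fin (n + 1) → Vtx d) :
    transProd p (p (Fin.last n)) = p 0 := by
  induction n with
  | zero => simp [transProd]
  | succ n ih =>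
    have := ih (Fin.tail p)
    rw [transProd_succ, Equiv.Perm.mul_apply]
    change Equiv.swap (p 0) (p 1) (transProd (Fin.tail p) (Fin.tail p (Fin.last n))) = _
    rw [this]
    exact Equiv.swap_apply_right _ _

theorem transProd_perm_comp {n : ℕ} (σ : Equiv.Perm (Vtx d)) (p : Fin (n + 1) → Vtx d) :
    transProd (fun i => σ (p i)) = σ * transProd p * σ⁻¹ := by
  rw [← MulAut.conj_apply, transProd, transProd, map_list_prod, List.map_map]
  congr 2
  funext i
  simp [Equiv.swap_apply_apply]

theorem isPath_succ {n : ℕ} (p : Fin (n + 2) → Vtx d) :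
    IsPath p ↔ (∃ a, p 1 = p 0 + step a) ∧ IsPath (Fin.tail p) := by
  rw [← dist1_eq_one_iff]
  exact Fin.forall_fin_succ

/-- The state space of the sliding puzzle: the position of the blank and the permutation. -/
abbrev State (d : ℕ) := Vtx d × Equiv.Perm (Vtx d)

/-- Moving the blank along the step `a`. -/
def move (a : Fin d × ℤˣ) : State d ≃ State d where
  toFun s := (s.1 + step a, s.2 * Equiv.swap s.1 (s.1 + step a))
  invFun s := (s.1 - step a, s.2 * Equiv.swap s.1 (s.1 - step a))
  left_inv s := by
    ext1 <;> simp [mul_assoc, Equiv.swap_comm]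
  right_inv s := by
    ext1 <;> simp [mul_assoc, Equiv.swap_comm]

theorem move_symm (i : Fin d) (u : ℤˣ) : (move (i, u)).symm = move (i, -u) := by
  ext1 s
  simp [move, step_neg, sub_eq_add_neg]

/-- The walk operator on arbitrary functions on the state space. -/
def walkOp (h : State d → ℂ) (s : State d) : ℂ := ∑ a, h (move a s)

/-- Paths from `s.1` along which the state evolves from `s` into `P`. -/
abbrev PathsTo (n : ℕ) (P : Set (State d)) (s : State d) :=
  {p : Fin (n + 1) → Vtx d // IsPath p ∧ p 0 = s.1 ∧ (p (Fin.last n), s.2 * transProd p) ∈ P}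

/-- A path is its first step followed by a path from the next site. -/
def pathsToSucc (n : ℕ) (P : Set (State d)) (s : State d) :
    (Σ a, PathsTo n P (move a s)) → PathsTo (n + 1) P s :=
  fun q => ⟨Fin.cons s.1 q.2.1, by
    obtain ⟨a, p, hp, h0, hP⟩ := q
    have h0' : p 0 = s.1 + step a := h0
    refine ⟨(isPath_succ _).2 ⟨⟨a, ?_⟩, by simpa using hp⟩, rfl, ?_⟩
    · simpa using h0'
    · rw [transProd_succ, ← mul_assoc]
      simp only [Fin.tail_cons, ← Fin.succ_last, Fin.cons_succ, Fin.cons_zero, Fin.cons_one, h0']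
      exact hP⟩

theorem pathsToSucc_bijective (n : ℕ) (P : Set (State d)) (s : State d) :
    Function.Bijective (pathsToSucc n P s) := by
  constructor
  · rintro ⟨a, p, hp, h0, hP⟩ ⟨b, q, hq, hq0, hQ⟩ h
    have hc : (Fin.cons s.1 p : Fin (n + 2) → Vtx d) = Fin.cons s.1 q := congrArg Subtype.val h
    obtain rfl : p = q := (Fin.cons_injective2 hc).2
    obtain rfl : a = b := step_injective (add_left_cancel (h0.symm.trans hq0))
    rfl
  · rintro ⟨p, hp, h0, hP⟩
    obtain ⟨⟨a, ha⟩, ht⟩ := (isPath_succ p).1 hp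
    rw [h0] at ha
    refine ⟨⟨a, Fin.tail p, ht, ha, ?_⟩, ?_⟩
    · rw [transProd_succ, h0, ha, ← mul_assoc] at hP
      exact hP
    · apply Subtype.ext
      change Fin.cons s.1 (Fin.tail p) = p
      rw [← h0]
      exact Fin.cons_self_tail p

theorem subsingleton_pathsTo_zero (P : Set (State d)) (s : State d) :
    Subsingleton (PathsTo 0 P s) := by
  refine ⟨fun p q => Subtype.ext (funext fun i => ?_)⟩
  rw [Fin.fin_one_eq_zero i, p.2.2.1, q.2.2.1]

theorem finite_pathsTo (n : ℕ) (P : Set (State d)) (s : State d) : Finite (PathsTo n P s) := by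
  induction n generalizing s with
  | zero =>
    have : Subsingleton (PathsTo 0 P s) := subsingleton_pathsTo_zero P s
    infer_instance
  | succ n ih => exact Finite.of_surjective _ (pathsToSucc_bijective n P s).2

theorem walkOp_iterate_indicator (n : ℕ) (P : Set (State d)) (s : State d) :
    (walkOp^[n] (P.indicator 1)) s = Nat.card (PathsTo n P s) := by
  induction n generalizing s with
  | zero =>
    by_cases hs : s ∈ P
    · have : Nat.card (PathsTo 0 P s) = 1 := by
        rw [Nat.card_eq_one_iff_unique]
        exact ⟨subsingleton_pathsTo_zero P s,
          ⟨⟨fun _ => s.1, fun i => i.elim0, rfl, by simpa [transProd] using hs⟩⟩⟩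
      simp [hs, this]
    · have : IsEmpty (PathsTo 0 P s) := ⟨fun ⟨p, _, h0, hP⟩ => hs (by
        simpa [transProd, h0] using hP)⟩
      simp [hs]
  | succ n ih =>
    have := fun s => finite_pathsTo n P s
    rw [Function.iterate_succ_apply', ← Nat.card_congr (Equiv.ofBijective _
      (pathsToSucc_bijective n P s)), Nat.card_sigma]
    simp [walkOp, ih]

theorem card_pathsTo_singleton (n : ℕ) (s : State d) : Nat.card (PathsTo n {s} s) = T n d := by
  obtain ⟨y, ρ⟩ := s
  have key (σ : Equiv.Perm (Vtx d)) (p : Fin (n + 1) → Vtx d) (h : transProd p = 1) :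
      transProd (fun i => σ (p i)) = 1 := by
    rw [transProd_perm_comp, h]
    simp
  refine Nat.card_congr
    { toFun := fun p => ⟨fun i => p.1 i - y, fun i => ?_, ?_, fun _ => trivial,
        key (Equiv.subRight y) _ ?_⟩
      invFun := fun p => ⟨fun i => p.1 i + y, fun i => ?_, ?_, ?_⟩
      left_inv := fun p => by simp
      right_inv := fun p => by simp }
  · simpa [dist1] using p.2.1 i
  · simpa [sub_eq_zero] using p.2.2.1
  · simpa using (Prod.ext_iff.1 p.2.2.2).2
  · simpa [dist1] using p.2.1 i
  · simpa using p.2.2.1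
  · have h1 := p.2.2.2.2
    have h2 := transProd_apply_last p.1
    rw [h1, p.2.2.1] at h2
    have h3 := key (Equiv.addRight y) p.1 h1
    simp only [Equiv.coe_addRight] at h3
    have h4 : p.1 (Fin.last n) = 0 := h2
    simp [h3, h4]


section Hilbert

open scoped InnerProductSpace

/-- Reindexing of square-summable families by a permutation of the index set. -/
def compEquiv {ι : Type*} (φ : ι ≃ ι) : lp (fun _ : ι => ℂ) 2 →ₗ[ℂ] lp (fun _ : ι => ℂ) 2 where
  toFun f := ⟨fun i => f (φ i),
    memℓp_gen (φ.summable_iff.2 ((lp.memℓp f).summable (by norm_num)))⟩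
  map_add' _ _ := rfl
  map_smul' _ _ := rfl

theorem compEquiv_apply {ι : Type*} (φ : ι ≃ ι) (f : lp (fun _ : ι => ℂ) 2) (i : ι) :
    compEquiv φ f i = f (φ i) := rfl

theorem inner_compEquiv_left {ι : Type*} (φ : ι ≃ ι) (f g : lp (fun _ : ι => ℂ) 2) :
    ⟪compEquiv φ f, g⟫_ℂ = ⟪f, compEquiv φ.symm g⟫_ℂ := by
  rw [lp.inner_eq_tsum, lp.inner_eq_tsum,
    ← φ.tsum_eq fun i => ⟪f i, compEquiv φ.symm g i⟫_ℂ]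
  simp [compEquiv_apply]

theorem norm_compEquiv {ι : Type*} (φ : ι ≃ ι) (f : lp (fun _ : ι => ℂ) 2) :
    ‖compEquiv φ f‖ = ‖f‖ := by
  have : ⟪compEquiv φ f, compEquiv φ f⟫_ℂ = ⟪f, f⟫_ℂ := by
    rw [inner_compEquiv_left]
    congr 1
    ext i
    simp [compEquiv_apply]
  rw [inner_self_eq_norm_sq_to_K, inner_self_eq_norm_sq_to_K] at this
  exact (sq_eq_sq₀ (norm_nonneg _) (norm_nonneg _)).1 (by exact_mod_cast this)

section Growth

variable {E : Type*} [NormedAddCommGroup E] [InnerProductSpace ℂ E] {Q : E →ₗ[ℂ] E}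

theorem norm_sq_le_of_isSymmetric (hQ : Q.IsSymmetric) (f : E) :
    ‖Q f‖ ^ 2 ≤ ‖f‖ * ‖Q (Q f)‖ := by
  calc ‖Q f‖ ^ 2 = ‖⟪Q f, Q f⟫_ℂ‖ := by simp [inner_self_eq_norm_sq_to_K]
    _ = ‖⟪f, Q (Q f)⟫_ℂ‖ := by rw [hQ]
    _ ≤ _ := norm_inner_le_norm _ _

theorem mul_norm_pow_le_of_isSymmetric (hQ : Q.IsSymmetric) {t : ℝ} {f : E}
    (h : t * ‖f‖ ≤ ‖Q f‖) (n : ℕ) : t * ‖(Q ^ n) f‖ ≤ ‖(Q ^ (n + 1)) f‖ := by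
  induction n with
  | zero => simpa using h
  | succ n ih =>
    have h1 := norm_sq_le_of_isSymmetric hQ ((Q ^ n) f)
    simp only [← Module.End.mul_apply, ← pow_succ'] at h1
    rcases eq_or_ne ((Q ^ n) f) 0 with h0 | h0
    · simp [pow_succ' Q, h0]
    · refine le_of_mul_le_mul_left ?_ (norm_pos_iff.2 h0)
      nlinarith [norm_nonneg ((Q ^ (n + 1)) f)]

theorem pow_mul_norm_le_of_isSymmetric (hQ : Q.IsSymmetric) {t : ℝ} (ht : 0 ≤ t) {f : E}
    (h : t * ‖f‖ ≤ ‖Q f‖) (n : ℕ) : t ^ n * ‖f‖ ≤ ‖(Q ^ n) f‖ := by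
  induction n with
  | zero => simp
  | succ n ih =>
    calc t ^ (n + 1) * ‖f‖ = t * (t ^ n * ‖f‖) := by ring
      _ ≤ t * ‖(Q ^ n) f‖ := by gcongr
      _ ≤ _ := mul_norm_pow_le_of_isSymmetric hQ h n

theorem norm_one_sub_sq_ge {A : E →ₗ[ℂ] E} (hA : A.IsSymmetric) {c : ℝ} (hc : 0 ≤ c) {δ : ℝ}
    {f : E} (hf : ‖A f‖ ≤ δ * ‖f‖) :
    (1 - c * δ ^ 2) * ‖f‖ ≤ ‖f - (c : ℂ) • A (A f)‖ := by
  rcases eq_or_ne f 0 with h0 | h0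
  · simp [h0]
  refine le_of_mul_le_mul_left ?_ (norm_pos_iff.2 h0)
  have h1 : ⟪f, f - (c : ℂ) • A (A f)⟫_ℂ = ((‖f‖ ^ 2 - c * ‖A f‖ ^ 2 : ℝ) : ℂ) := by
    rw [inner_sub_right, inner_smul_right, ← hA, inner_self_eq_norm_sq_to_K,
      inner_self_eq_norm_sq_to_K]
    simp
  have h2 := norm_inner_le_norm (𝕜 := ℂ) f (f - (c : ℂ) • A (A f))
  rw [h1, Complex.norm_real] at h2
  have h3 : ‖A f‖ ^ 2 ≤ (δ * ‖f‖) ^ 2 := by gcongr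
  calc ‖f‖ * ((1 - c * δ ^ 2) * ‖f‖) = ‖f‖ ^ 2 - c * (δ * ‖f‖) ^ 2 := by ring
    _ ≤ ‖f‖ ^ 2 - c * ‖A f‖ ^ 2 := by gcongr
    _ ≤ _ := (le_abs_self _).trans h2

/-- If the iterates of a symmetric operator decay at rate `r` on the vectors `v s`, then it
contracts no nonzero combination of them by less than the factor `r`. -/
theorem le_of_pow_bound (hQ : Q.IsSymmetric) {S : Type*} {v : S → E} {r t : ℝ} (hr : 0 ≤ r)
    (hv : ∀ s n, ‖(Q ^ n) (v s)‖ ≤ r ^ n) (F : Finset S) (c : S → ℂ)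
    (h0 : ∑ s ∈ F, c s • v s ≠ 0)
    (h : t * ‖∑ s ∈ F, c s • v s‖ ≤ ‖Q (∑ s ∈ F, c s • v s)‖) : t ≤ r := by
  by_contra! hrt
  have ht : 0 < t := hr.trans_lt hrt
  have key (n : ℕ) : ‖∑ s ∈ F, c s • v s‖ ≤ (∑ s ∈ F, ‖c s‖) * (r / t) ^ n := by
    have h1 := pow_mul_norm_le_of_isSymmetric hQ ht.le h n
    have h2 : ‖(Q ^ n) (∑ s ∈ F, c s • v s)‖ ≤ (∑ s ∈ F, ‖c s‖) * r ^ n := by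
      rw [map_sum, Finset.sum_mul]
      refine norm_sum_le_of_le _ fun s _ => ?_
      rw [map_smul, norm_smul]
      gcongr
      exact hv s n
    rw [div_pow, mul_div_assoc', le_div_iff₀ (by positivity)]
    linarith
  have hlim : Filter.Tendsto (fun n : ℕ => (∑ s ∈ F, ‖c s‖) * (r / t) ^ n) Filter.atTop
      (nhds ((∑ s ∈ F, ‖c s‖) * 0)) :=
    (tendsto_pow_atTop_nhds_zero_of_lt_one (by positivity) ((div_lt_one ht).2 hrt)).const_mul _
  rw [mul_zero] at hlim
  exact h0 (norm_le_zero_iff.1 (ge_of_tendsto' hlim key))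

end Growth

/-- The adjacency operator of the sliding puzzle graph on the square-summable functions. -/
noncomputable def adj (d : ℕ) :
    lp (fun _ : State d => ℂ) 2 →ₗ[ℂ] lp (fun _ : State d => ℂ) 2 :=
  ∑ a, compEquiv (move a)

theorem adj_isSymmetric : (adj d).IsSymmetric := by
  intro f g
  simp only [adj, LinearMap.sum_apply, sum_inner, inner_sum, inner_compEquiv_left]
  refine Fintype.sum_equiv ((Equiv.refl _).prodCongr (Equiv.neg _)) _ _ ?_
  rintro ⟨i, u⟩
  simp [move_symm]

theorem coe_adj (f : lp (fun _ : State d => ℂ) 2) : ⇑(adj d f) = walkOp f := by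
  rw [adj, LinearMap.sum_apply, lp.coeFn_sum]
  funext s
  exact Finset.sum_apply s _ _

theorem coe_adj_pow (n : ℕ) (f : lp (fun _ : State d => ℂ) 2) :
    ⇑((adj d ^ n) f) = walkOp^[n] f := by
  induction n with
  | zero => rfl
  | succ n ih => rw [pow_succ', Module.End.mul_apply, coe_adj, ih, Function.iterate_succ_apply']

/-- The point mass at a state. -/
noncomputable def pointMass (s : State d) : lp (fun _ : State d => ℂ) 2 :=
  open scoped Classical in lp.single 2 s 1

theorem coe_pointMass (s : State d) : ⇑(pointMass s) = Set.indicator {s} 1 := by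
  classical
  ext t
  simp [pointMass, lp.single_apply, Pi.single_apply, Set.indicator_apply]

theorem inner_pointMass (s : State d) (f : lp (fun _ : State d => ℂ) 2) :
    ⟪pointMass s, f⟫_ℂ = f s := by
  simp [pointMass, lp.inner_single_left]

theorem inner_adj_pow_pointMass (n : ℕ) (s : State d) :
    ⟪pointMass s, (adj d ^ n) (pointMass s)⟫_ℂ = T n d := by
  rw [inner_pointMass, coe_adj_pow, coe_pointMass, walkOp_iterate_indicator,
    card_pathsTo_singleton]

end Hilbert

section Moments

open scoped InnerProductSpace
open Polynomial

variable {μ : Measure ℝ} [IsProbabilityMeasure μ] {R : ℝ}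

theorem integrable_of_continuous_of_measure_Icc (hsupp : μ (Set.Icc (-R) R) = 1) {g : ℝ → ℝ}
    (hg : Continuous g) : Integrable g μ := by
  obtain ⟨C, hC⟩ := isCompact_Icc.exists_bound_of_continuousOn (s := Set.Icc (-R) R) hg.continuousOn
  refine Integrable.of_bound hg.aestronglyMeasurable C ?_
  filter_upwards [(mem_ae_iff_prob_eq_one measurableSet_Icc).2 hsupp] with x hx using hC x hx

theorem inner_aeval_adj_pointMass (hsupp : μ (Set.Icc (-R) R) = 1)
    (hmom : ∀ n : ℕ, ∫ x, x ^ n ∂μ = (T n d : ℝ)) (s : State d) (P : ℝ[X]) :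
    ⟪pointMass s, aeval (adj d) (P.map Complex.ofRealHom) (pointMass s)⟫_ℂ
      = ((∫ x, P.eval x ∂μ : ℝ) : ℂ) := by
  induction P using Polynomial.induction_on' with
  | add p q hp hq =>
    simp only [Polynomial.map_add, map_add, LinearMap.add_apply, inner_add_right, hp, hq, eval_add]
    rw [integral_add (integrable_of_continuous_of_measure_Icc hsupp p.continuous)
      (integrable_of_continuous_of_measure_Icc hsupp q.continuous)]
    push_cast
    rfl
  | monomial n a =>
    simp only [map_monomial, aeval_monomial, eval_monomial, integral_const_mul, hmom]
    rw [Module.End.mul_apply, Module.algebraMap_end_apply, inner_smul_right,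
      inner_adj_pow_pointMass]
    simp

/-- The polynomial `1 - c (x - l)²`. -/
noncomputable def bump (c l : ℝ) : ℝ[X] := 1 - C c * (X - C l) ^ 2

theorem aeval_bump (c l : ℝ) (f : lp (fun _ : State d => ℂ) 2) :
    aeval (adj d) ((bump c l).map Complex.ofRealHom) f
      = f - (c : ℂ) • (adj d - (l : ℂ) • 1) ((adj d - (l : ℂ) • 1) f) := by
  have : aeval (adj d) ((bump c l).map Complex.ofRealHom)
      = 1 - (c : ℂ) • ((adj d - (l : ℂ) • 1) * (adj d - (l : ℂ) • 1)) := by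
    simp [bump, pow_two, Algebra.algebraMap_eq_smul_one]
  rw [this]
  rfl

theorem isSymmetric_adj_sub (l : ℝ) : (adj d - (l : ℂ) • 1).IsSymmetric :=
  adj_isSymmetric.sub (LinearMap.IsSymmetric.one.smul (by simp))

theorem isSymmetric_aeval_bump (c l : ℝ) :
    (aeval (adj d) ((bump c l).map Complex.ofRealHom)).IsSymmetric := by
  intro f g
  have hA := isSymmetric_adj_sub (d := d) l
  rw [aeval_bump, aeval_bump, inner_sub_left, inner_sub_right, inner_smul_left, inner_smul_right,
    hA, hA]
  simp

theorem norm_pow_aeval_bump_pointMass_le (hsupp : μ (Set.Icc (-R) R) = 1)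
    (hmom : ∀ n : ℕ, ∫ x, x ^ n ∂μ = (T n d : ℝ)) {c l r : ℝ} (hr : 0 ≤ r)
    (h : ∀ᵐ x ∂μ, |(bump c l).eval x| ≤ r) (s : State d) (n : ℕ) :
    ‖((aeval (adj d) ((bump c l).map Complex.ofRealHom)) ^ n) (pointMass s)‖ ≤ r ^ n := by
  set Q := aeval (adj d) ((bump c l).map Complex.ofRealHom) with hQdef
  have hQ : (Q ^ n).IsSymmetric := (isSymmetric_aeval_bump c l).pow n
  have h1 : ⟪(Q ^ n) (pointMass s), (Q ^ n) (pointMass s)⟫_ℂ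
      = ((∫ x, ((bump c l) ^ (n + n)).eval x ∂μ : ℝ) : ℂ) := by
    rw [hQ, ← Module.End.mul_apply, ← pow_add, hQdef, ← map_pow, ← Polynomial.map_pow,
      inner_aeval_adj_pointMass hsupp hmom]
  rw [inner_self_eq_norm_sq_to_K] at h1
  have h2 : ‖(Q ^ n) (pointMass s)‖ ^ 2 = ∫ x, ((bump c l) ^ (n + n)).eval x ∂μ := by
    exact Complex.ofReal_injective (by simpa using h1)
  have h3 : ∫ x, ((bump c l) ^ (n + n)).eval x ∂μ ≤ ∫ _, r ^ (n + n) ∂μ := by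
    refine integral_mono_ae (integrable_of_continuous_of_measure_Icc hsupp (Polynomial.continuous _))
      (integrable_const _) ?_
    filter_upwards [h] with x hx
    rw [eval_pow]
    refine (le_abs_self _).trans ?_
    rw [abs_pow]
    gcongr
  rw [← h2] at h3
  simp only [integral_const, probReal_univ, one_smul] at h3
  refine (sq_le_sq₀ (norm_nonneg _) (by positivity)).1 (h3.trans_eq (by ring))

end Moments

section Folner

open scoped InnerProductSpace

/-- The box `[0, L)^d`. -/
noncomputable def box (d L : ℕ) : Finset (Vtx d) := Fintype.piFinset fun _ => Finset.Ico 0 (L : ℤ)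

theorem mem_box {L : ℕ} {x : Vtx d} : x ∈ box d L ↔ ∀ i, 0 ≤ x i ∧ x i < L := by
  simp [box]

theorem card_box_step {L : ℕ} (hL : 1 ≤ L) (a : Fin d × ℤˣ) :
    (L - 1 : ℝ) * (box d L).card ≤ L * ((box d L).filter fun x => x + step a ∈ box d L).card := by
  obtain ⟨i, u⟩ := a
  have hcard (J : Finset ℤ) :
      (Fintype.piFinset (Function.update (fun _ : Fin d => Finset.Ico 0 (L : ℤ)) i J)).card
        = J.card * ∏ _j ∈ Finset.univ \ {i}, L := by
    have : (fun j => (Function.update (fun _ : Fin d => Finset.Ico 0 (L : ℤ)) i J j).card)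
        = Function.update (fun _ => L) i J.card := by
      ext j
      by_cases hj : j = i
      · subst hj; simp
      · simp [hj]
    rw [Fintype.card_piFinset, this, Finset.prod_update_of_mem (Finset.mem_univ i)]
  obtain ⟨J, hJc, hJ⟩ : ∃ J : Finset ℤ, J.card = L - 1 ∧
      ∀ k ∈ J, (0 ≤ k ∧ k < L) ∧ 0 ≤ k + u ∧ k + u < L := by
    rcases Int.units_eq_one_or u with rfl | rfl
    · refine ⟨Finset.Ico 0 (L - 1), by simp, fun k hk => ?_⟩
      simp only [Finset.mem_Ico, Units.val_one] at hk ⊢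
      omega
    · refine ⟨Finset.Ico 1 L, by simp, fun k hk => ?_⟩
      simp only [Finset.mem_Ico, Units.val_neg, Units.val_one] at hk ⊢
      omega
  have hbox := hcard (Finset.Ico 0 (L : ℤ))
  rw [Function.update_eq_self_iff.2 rfl] at hbox
  have hsub : Fintype.piFinset (Function.update (fun _ : Fin d => Finset.Ico 0 (L : ℤ)) i J)
      ⊆ (box d L).filter fun x => x + step (i, u) ∈ box d L := by
    intro x hx
    rw [Fintype.mem_piFinset] at hx
    have hxi := hJ (x i) (by simpa using hx i)
    have hxj (j : Fin d) (hj : j ≠ i) : 0 ≤ x j ∧ x j < L := by simpa [hj] using hx j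
    rw [Finset.mem_filter, mem_box, mem_box]
    refine ⟨fun j => ?_, fun j => ?_⟩
    · by_cases hj : j = i
      · subst hj; exact hxi.1
      · exact hxj j hj
    · by_cases hj : j = i
      · subst hj; simpa [step] using hxi.2
      · simpa [step, hj] using hxj j hj
  have hle := Finset.card_le_card hsub
  rw [hcard, hJc] at hle
  have hle' : ((L - 1 : ℕ) : ℝ) * (∏ _j ∈ Finset.univ \ {i}, L : ℕ)
      ≤ ((box d L).filter fun x => x + step (i, u) ∈ box d L).card := by exact_mod_cast hle
  have hbox' : ((box d L).card : ℝ) = L * (∏ _j ∈ Finset.univ \ {i}, L : ℕ) := by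
    rw [box, hbox]
    simp
  rw [hbox']
  rw [Nat.cast_sub hL, Nat.cast_one] at hle'
  have hL0 : (0 : ℝ) ≤ L := Nat.cast_nonneg L
  nlinarith

/-- The permutations fixing every point outside `B`. -/
def permsIn (B : Finset (Vtx d)) : Set (Equiv.Perm (Vtx d)) := {π | ∀ x, x ∉ B → π x = x}

theorem finite_permsIn (B : Finset (Vtx d)) : (permsIn B).Finite := by
  exact Set.finite_coe_iff.1 (Finite.of_equiv _ (Equiv.Perm.subtypeEquivSubtypePerm (· ∈ B)))

theorem mul_swap_mem_permsIn {B : Finset (Vtx d)} {π : Equiv.Perm (Vtx d)} (hπ : π ∈ permsIn B)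
    {x y : Vtx d} (hx : x ∈ B) (hy : y ∈ B) : π * Equiv.swap x y ∈ permsIn B := by
  intro z hz
  have hzx : z ≠ x := by rintro rfl; exact hz hx
  have hzy : z ≠ y := by rintro rfl; exact hz hy
  rw [Equiv.Perm.mul_apply, Equiv.swap_apply_of_ne_of_ne hzx hzy, hπ z hz]

/-- The states whose blank and whose displaced tiles lie in the box `[0, L)^d`. -/
noncomputable def folner (d L : ℕ) : Finset (State d) :=
  box d L ×ˢ (finite_permsIn (box d L)).toFinset

theorem folner_nonempty {L : ℕ} (hL : 1 ≤ L) : (folner d L).Nonempty := by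
  refine ⟨(0, 1), ?_⟩
  simp only [folner, Finset.mem_product, mem_box, Set.Finite.mem_toFinset]
  exact ⟨fun _ => ⟨le_rfl, by simpa using Nat.pos_of_ne_zero (by omega)⟩, fun _ _ => rfl⟩

theorem card_folner_move {L : ℕ} (hL : 1 ≤ L) (a : Fin d × ℤˣ) :
    open scoped Classical in
    (L - 1 : ℝ) * (folner d L).card
      ≤ L * ((folner d L).filter fun s => move a s ∈ folner d L).card := by
  classical
  have hsub : ((box d L).filter fun x => x + step a ∈ box d L) ×ˢ
      (finite_permsIn (box d L)).toFinset
      ⊆ (folner d L).filter fun s => move a s ∈ folner d L := by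
    rintro ⟨x, π⟩ h
    simp only [folner, Finset.mem_product, Finset.mem_filter, Set.Finite.mem_toFinset] at h ⊢
    exact ⟨⟨h.1.1, h.2⟩, h.1.2, mul_swap_mem_permsIn h.2 h.1.1 h.1.2⟩
  have hle := Finset.card_le_card hsub
  rw [Finset.card_product] at hle
  have hle' : (((box d L).filter fun x => x + step a ∈ box d L).card : ℝ)
      * ((finite_permsIn (box d L)).toFinset.card : ℝ)
      ≤ ((folner d L).filter fun s => move a s ∈ folner d L).card := by exact_mod_cast hle
  have hbox := card_box_step hL a
  rw [folner, Finset.card_product, ← folner]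
  push_cast
  calc _ = ((L - 1 : ℝ) * (box d L).card) * ((finite_permsIn (box d L)).toFinset.card : ℝ) := by
        ring
    _ ≤ (L * ((box d L).filter fun x => x + step a ∈ box d L).card)
        * ((finite_permsIn (box d L)).toFinset.card : ℝ) := by gcongr
    _ ≤ _ := by
        rw [mul_assoc]
        gcongr

/-- The character `w ^ (x₁ + ⋯ + x_d)` of the blank's position. -/
noncomputable def character (w : ℂ) (s : State d) : ℂ := w ^ (∑ i, s.1 i)

theorem character_move {w : ℂ} (hw : w ≠ 0) (a : Fin d × ℤˣ) (s : State d) :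
    character w (move a s) = w ^ (a.2 : ℤ) * character w s := by
  have : ∑ i, (s.1 i + step a i) = (a.2 : ℤ) + ∑ i, s.1 i := by
    rw [Finset.sum_add_distrib, add_comm]
    simp [step]
  rw [character, character, ← zpow_add₀ hw, ← this]
  rfl

/-- The character `w` cut off to the Følner set. -/
noncomputable def trialVector (d L : ℕ) (w : ℂ) : lp (fun _ : State d => ℂ) 2 :=
  ∑ s ∈ folner d L, character w s • pointMass s

theorem inner_trialVector (L : ℕ) (w : ℂ) (g : lp (fun _ : State d => ℂ) 2) :
    ⟪trialVector d L w, g⟫_ℂ = ∑ s ∈ folner d L, star (character w s) * g s := by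
  rw [trialVector, sum_inner]
  refine Finset.sum_congr rfl fun s _ => ?_
  rw [inner_smul_left, inner_pointMass, starRingEnd_apply]

theorem trialVector_apply (L : ℕ) (w : ℂ) (s : State d) :
    open scoped Classical in
    trialVector d L w s = if s ∈ folner d L then character w s else 0 := by
  classical
  rw [← inner_pointMass, trialVector, inner_sum]
  simp [inner_smul_right, inner_pointMass, coe_pointMass, Set.indicator_apply]

variable {w : ℂ}

theorem star_character_mul (hw : ‖w‖ = 1) (s : State d) :
    star (character w s) * character w s = 1 := by
  have : ‖character w s‖ = 1 := by simp [character, hw]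
  rw [← starRingEnd_apply, ← Complex.normSq_eq_conj_mul_self, Complex.normSq_eq_norm_sq, this]
  simp

theorem norm_sq_trialVector (hw : ‖w‖ = 1) (L : ℕ) :
    ‖trialVector d L w‖ ^ 2 = (folner d L).card := by
  have h : ⟪trialVector d L w, trialVector d L w⟫_ℂ = (folner d L).card := by
    rw [inner_trialVector, Finset.card_eq_sum_ones, Nat.cast_sum]
    refine Finset.sum_congr rfl fun s hs => ?_
    rw [trialVector_apply, if_pos hs, star_character_mul hw, Nat.cast_one]
  rw [inner_self_eq_norm_sq_to_K] at h
  exact Complex.ofReal_injective (by simpa using h)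

theorem inner_trialVector_compEquiv (hw : ‖w‖ = 1) (L : ℕ) (a : Fin d × ℤˣ) :
    open scoped Classical in
    ⟪trialVector d L w, compEquiv (move a) (trialVector d L w)⟫_ℂ
      = w ^ (a.2 : ℤ) * ((folner d L).filter fun s => move a s ∈ folner d L).card := by
  classical
  have hw0 : w ≠ 0 := by
    rintro rfl
    simp at hw
  rw [inner_trialVector, Finset.card_filter, Nat.cast_sum, Finset.mul_sum]
  refine Finset.sum_congr rfl fun s _ => ?_
  rw [compEquiv_apply, trialVector_apply]
  split_ifs
  · rw [character_move hw0, mul_left_comm, star_character_mul hw]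
    simp
  · simp

theorem norm_compEquiv_sub_trialVector_le (hw : ‖w‖ = 1) {L : ℕ} (hL : 1 ≤ L)
    (a : Fin d × ℤˣ) :
    ‖compEquiv (move a) (trialVector d L w) - w ^ (a.2 : ℤ) • trialVector d L w‖
      ≤ √(2 / L) * ‖trialVector d L w‖ := by
  classical
  have hwa : ‖w ^ (a.2 : ℤ)‖ = 1 := by simp [hw]
  have h1 := norm_sub_rev (compEquiv (move a) (trialVector d L w))
    (w ^ (a.2 : ℤ) • trialVector d L w)
  have h2 := norm_sub_sq (𝕜 := ℂ) (w ^ (a.2 : ℤ) • trialVector d L w)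
    (compEquiv (move a) (trialVector d L w))
  have h3 : (starRingEnd ℂ) (w ^ (a.2 : ℤ)) * w ^ (a.2 : ℤ) = 1 := by
    rw [← Complex.normSq_eq_conj_mul_self, Complex.normSq_eq_norm_sq, hwa]
    simp
  rw [inner_smul_left, inner_trialVector_compEquiv hw, norm_compEquiv, norm_smul, hwa, one_mul,
    norm_sq_trialVector hw, ← mul_assoc, h3, one_mul, ← h1] at h2
  simp only [RCLike.natCast_re] at h2
  have hc := card_folner_move hL a
  have hL0 : (0 : ℝ) < L := by exact_mod_cast hL
  refine abs_le_of_sq_le_sq' ?_ (by positivity) |>.2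
  rw [mul_pow, Real.sq_sqrt (by positivity), norm_sq_trialVector hw, h2, div_mul_eq_mul_div,
    le_div_iff₀ hL0]
  linarith

theorem norm_adj_sub_trialVector_le (hw : ‖w‖ = 1) {l : ℝ} (hl : d * (w + w⁻¹) = l) {L : ℕ}
    (hL : 1 ≤ L) :
    ‖(adj d - (l : ℂ) • 1) (trialVector d L w)‖
      ≤ (2 * d * √(2 / L)) * ‖trialVector d L w‖ := by
  have hsum : ∑ a : Fin d × ℤˣ, w ^ (a.2 : ℤ) = l := by
    rw [Fintype.sum_prod_type, ← hl]
    have hU : (Finset.univ : Finset ℤˣ) = {1, -1} := rfl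
    simp [hU, mul_add]
  have h : (adj d - (l : ℂ) • 1) (trialVector d L w) = ∑ a : Fin d × ℤˣ,
      (compEquiv (move a) (trialVector d L w) - w ^ (a.2 : ℤ) • trialVector d L w) := by
    rw [Finset.sum_sub_distrib, ← Finset.sum_smul, hsum]
    rw [LinearMap.sub_apply, adj, LinearMap.sum_apply]
    rfl
  rw [h]
  refine (norm_sum_le_of_le _ fun a _ => norm_compEquiv_sub_trialVector_le hw hL a).trans_eq ?_
  simp
  ring

end Folner

open Polynomial in
theorem measure_pos_of_mem_Icc (hd : 1 ≤ d) {μ : Measure ℝ} [IsProbabilityMeasure μ]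
    (hsupp : μ (Set.Icc (-(2 * d : ℝ)) (2 * d)) = 1)
    (hmom : ∀ n : ℕ, ∫ x, x ^ n ∂μ = (T n d : ℝ)) {l : ℝ}
    (hl : l ∈ Set.Icc (-(2 * d : ℝ)) (2 * d)) {U : Set ℝ} (hU : IsOpen U) (hlU : l ∈ U) :
    0 < μ U := by
  by_contra hμ
  have hμU : μ U = 0 := by simpa using hμ
  have hd0 : (1 : ℝ) ≤ d := by exact_mod_cast hd
  obtain ⟨ε₀, hε₀, hball⟩ := Metric.isOpen_iff.1 hU l hlU
  obtain ⟨ε, hε, hε1, hεε₀⟩ : ∃ ε : ℝ, 0 < ε ∧ ε ≤ 1 ∧ ε ≤ ε₀ :=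
    ⟨min 1 ε₀, lt_min one_pos hε₀, min_le_left _ _, min_le_right _ _⟩
  obtain ⟨w, hw, hwl⟩ : ∃ w : ℂ, ‖w‖ = 1 ∧ d * (w + w⁻¹) = (l : ℂ) := by
    refine ⟨Complex.exp (Real.arccos (l / (2 * d)) * Complex.I),
      Complex.norm_exp_ofReal_mul_I _, ?_⟩
    have hcos : Real.cos (Real.arccos (l / (2 * d))) = l / (2 * d) := by
      apply Real.cos_arccos
      · rw [le_div_iff₀ (by positivity)]
        linarith [hl.1]
      · rw [div_le_one (by positivity)]
        exact hl.2
    have h2 := Complex.two_cos (Real.arccos (l / (2 * d)) : ℂ)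
    rw [← Complex.exp_neg, ← neg_mul, ← h2, ← Complex.ofReal_cos, hcos]
    have : (d : ℂ) ≠ 0 := by exact_mod_cast (by omega : d ≠ 0)
    push_cast
    field_simp
  obtain ⟨L, hL⟩ := exists_nat_gt (8 * d ^ 2 / ε ^ 2 : ℝ)
  have hL0 : (0 : ℝ) < L := lt_of_le_of_lt (by positivity) hL
  have hL1 : 1 ≤ L := by exact_mod_cast hL0
  set c : ℝ := 1 / (16 * d ^ 2) with hc
  have hc0 : 0 < c := by positivity
  have hcd : c * (16 * d ^ 2) = 1 := by
    rw [hc]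
    field_simp
  have hr : 0 ≤ 1 - c * ε ^ 2 := by
    have : ε ^ 2 ≤ 16 * (d : ℝ) ^ 2 := by nlinarith
    nlinarith
  have hbump : ∀ᵐ x ∂μ, |(bump c l).eval x| ≤ 1 - c * ε ^ 2 := by
    filter_upwards [(mem_ae_iff_prob_eq_one measurableSet_Icc).2 hsupp,
      measure_eq_zero_iff_ae_notMem.1 hμU] with x hx hxU
    have hfar : ε ≤ |x - l| := by
      by_contra! hlt
      exact hxU (hball (by rw [Metric.mem_ball, Real.dist_eq]; linarith))
    have hnear : |x - l| ≤ 4 * d := abs_le.2 ⟨by linarith [hx.1, hl.2], by linarith [hx.2, hl.1]⟩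
    have h1 : ε ^ 2 ≤ (x - l) ^ 2 := by rw [← sq_abs (x - l)]; gcongr
    have h2 : (x - l) ^ 2 ≤ 16 * d ^ 2 := by
      rw [← sq_abs (x - l)]
      calc |x - l| ^ 2 ≤ (4 * d) ^ 2 := by gcongr
        _ = _ := by ring
    simp only [bump, eval_sub, eval_one, eval_mul, eval_C, eval_pow, eval_X]
    rw [abs_of_nonneg (by nlinarith)]
    gcongr
  set δ : ℝ := 2 * d * √(2 / L) with hδ
  have hA := norm_adj_sub_trialVector_le hw hwl hL1
  have hQ := norm_one_sub_sq_ge (isSymmetric_adj_sub (d := d) l) hc0.le hA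
  rw [← aeval_bump] at hQ
  have hne : trialVector d L w ≠ 0 := by
    intro h0
    have := norm_sq_trialVector (d := d) hw L
    rw [h0] at this
    have hpos : (0 : ℝ) < (folner d L).card := by exact_mod_cast (folner_nonempty hL1).card_pos
    simp only [norm_zero] at this
    linarith
  have hle := le_of_pow_bound (isSymmetric_aeval_bump c l) hr
    (fun s n => norm_pow_aeval_bump_pointMass_le hsupp hmom hr hbump s n) _ _ hne hQ
  have hδε : δ ^ 2 < ε ^ 2 := by
    rw [hδ, mul_pow, Real.sq_sqrt (by positivity)]
    rw [div_lt_iff₀ (by positivity)] at hL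
    rw [mul_div_assoc', div_lt_iff₀ hL0]
    linarith
  nlinarith

end Umpteen

/-- **Lemma (the support of the integrated density of states is `[−2d, 2d]`).**
For `d ≥ 1`, every probability measure supported in `[−2d, 2d]` whose moments are
`T_n(d)` has topological support equal to the whole interval `[−2d, 2d]`. -/
theorem umpteen_ids_full_support (d : ℕ) (hd : 1 ≤ d)
    (μ : Measure ℝ) (hμ : IsProbabilityMeasure μ)
    (hsupp : μ (Set.Icc (-(2 * d : ℝ)) (2 * d)) = 1)
    (hmom : ∀ n : ℕ, ∫ x, x ^ n ∂μ = (T n d : ℝ)) :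
    {x : ℝ | ∀ U : Set ℝ, IsOpen U → x ∈ U → 0 < μ U}
      = Set.Icc (-(2 * d : ℝ)) (2 * d) := by
  ext x
  refine ⟨fun h => ?_, fun hx U hU hxU => Umpteen.measure_pos_of_mem_Icc hd hsupp hmom hx hU hxU⟩
  by_contra hx
  refine (h _ isClosed_Icc.isOpen_compl hx).ne' ?_
  rwa [prob_compl_eq_zero_iff measurableSet_Icc]
end

section
/- For every integer d ≥ 1 there exists a probability measure μ on ℝ with μ([−2d, 2d]) = 1 such that ∫ λ^n dμ(λ) = T_n(d) for every integer n ≥ 0. -/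
open scoped BigOperators

open MeasureTheory

/-- The spectral measure of a self-adjoint operator at a unit vector, characterised by its
moments. -/
theorem exists_spectral_measure {E : Type*} [NormedAddCommGroup E] [InnerProductSpace ℂ E]
    [CompleteSpace E] {A : E →L[ℂ] E} (hA : IsSelfAdjoint A) {v : E} (hv : ‖v‖ = 1) {C : ℝ}
    (hC : ‖A‖ ≤ C) :
    ∃ μ : Measure ℝ, IsProbabilityMeasure μ ∧ μ (Set.Icc (-C) C) = 1 ∧
      ∀ n : ℕ, ∫ x, x ^ n ∂μ = (inner ℂ v ((A ^ n) v)).re := by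
  have hne : Nontrivial E := ⟨v, 0, fun h => by simp [h] at hv⟩
  let L : C(spectrum ℝ A, ℝ) →ₗ[ℝ] ℝ :=
    { toFun := fun f => (inner ℂ v (cfcHom hA f v)).re
      map_add' := fun f g => by simp
      map_smul' := fun r f => by
        rw [map_smul]
        simp [inner_smul_right_eq_smul] }
  have hL : ∀ f, 0 ≤ f → 0 ≤ L f := fun f hf => by
    have := (ContinuousLinearMap.nonneg_iff_isPositive _).1 ((cfcHom_nonneg_iff hA).2 hf)
    exact this.re_inner_nonneg_right v
  let Λ : CompactlySupportedContinuousMap (spectrum ℝ A) ℝ →ₚ[ℝ] ℝ :=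
    PositiveLinearMap.mk₀
      { toFun := fun f => L f.toContinuousMap
        map_add' := fun f g => L.map_add f.toContinuousMap g.toContinuousMap
        map_smul' := fun r f => L.map_smul r f.toContinuousMap }
      (fun f hf => hL _ hf)
  have hΛ : ∀ f : C(spectrum ℝ A, ℝ), ∫ x, f x ∂(RealRMK.rieszMeasure Λ) = L f := fun f =>
    RealRMK.integral_rieszMeasure Λ (CompactlySupportedContinuousMap.continuousMapEquiv f)
  have hpow : ∀ n : ℕ, ∫ x, (x : ℝ) ^ n ∂(RealRMK.rieszMeasure Λ) =
      (inner ℂ v ((A ^ n) v)).re := fun n => by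
    have h := hΛ ((ContinuousMap.restrict (spectrum ℝ A) (ContinuousMap.id ℝ)) ^ n)
    have h2 : cfcHom hA ((ContinuousMap.restrict (spectrum ℝ A) (ContinuousMap.id ℝ)) ^ n)
      = A ^ n := by rw [map_pow, cfcHom_id]
    change _ = (inner ℂ v (cfcHom hA _ v)).re at h
    rw [h2] at h
    exact h
  have hprob : IsProbabilityMeasure (RealRMK.rieszMeasure Λ) := by
    have h := hpow 0
    simp only [pow_zero, integral_const, smul_eq_mul, mul_one,
      one_apply_eq_self, inner_self_eq_norm_sq_to_K, hv] at h
    constructor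
    rw [← ENNReal.toReal_eq_one_iff]
    simpa [Measure.real] using h
  have hmeas : Measurable (Subtype.val : spectrum ℝ A → ℝ) := measurable_subtype_coe
  refine ⟨(RealRMK.rieszMeasure Λ).map Subtype.val,
    Measure.isProbabilityMeasure_map hmeas.aemeasurable, ?_, fun n => ?_⟩
  · rw [Measure.map_apply hmeas measurableSet_Icc]
    convert measure_univ (μ := RealRMK.rieszMeasure Λ)
    refine Set.eq_univ_of_forall fun x => ?_
    have := spectrum.norm_le_norm_of_mem (spectrum.algebraMap_mem ℂ x.2)
    simp only [Complex.coe_algebraMap, Complex.norm_real, Real.norm_eq_abs] at this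
    exact abs_le.1 (this.trans hC)
  · rw [integral_map hmeas.aemeasurable (by fun_prop)]
    exact hpow n

theorem Memℓp.comp_perm {S : Type*} (τ : Equiv.Perm S) {f : S → ℂ}
    (hf : Memℓp (E := fun _ : S => ℂ) f 2) :
    Memℓp (E := fun _ : S => ℂ) (fun x => f (τ x)) 2 := by
  rw [memℓp_gen_iff (by simp)] at hf ⊢
  exact (τ.summable_iff (f := fun x => ‖f x‖ ^ (2 : ENNReal).toReal)).2 hf

/-- The isometry of `ℓ²(S)` permuting coordinates along `τ`. -/
noncomputable def permL2 {S : Type*} (τ : Equiv.Perm S) :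
    lp (fun _ : S => ℂ) 2 →L[ℂ] lp (fun _ : S => ℂ) 2 :=
  LinearIsometry.toContinuousLinearMap
    { toFun := fun f => ⟨fun x => f (τ.symm x), (lp.memℓp f).comp_perm τ.symm⟩
      map_add' := fun f g => rfl
      map_smul' := fun r f => rfl
      norm_map' := fun f => by
        rw [lp.norm_eq_tsum_rpow (by simp), lp.norm_eq_tsum_rpow (by simp)]
        congr 1
        exact τ.symm.tsum_eq (fun x => ‖f x‖ ^ (2 : ENNReal).toReal) }

theorem permL2_apply {S : Type*} (τ : Equiv.Perm S) (f : lp (fun _ : S => ℂ) 2) (x : S) :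
    permL2 τ f x = f (τ.symm x) := rfl

theorem norm_permL2_le {S : Type*} (τ : Equiv.Perm S) : ‖permL2 τ‖ ≤ 1 :=
  LinearIsometry.norm_toContinuousLinearMap_le _

theorem inner_permL2_left {S : Type*} (τ : Equiv.Perm S) (f g : lp (fun _ : S => ℂ) 2) :
    inner ℂ (permL2 τ f) g = inner ℂ f (permL2 τ.symm g) := by
  rw [lp.inner_eq_tsum, lp.inner_eq_tsum, ← τ.tsum_eq]
  simp [permL2_apply]

theorem isSelfAdjoint_sum_permL2 {S ι : Type*} [Fintype ι] {τ : ι → Equiv.Perm S}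
    (σ : Equiv.Perm ι) (hσ : ∀ i, τ (σ i) = (τ i).symm) :
    IsSelfAdjoint (∑ i, permL2 (τ i)) := by
  rw [ContinuousLinearMap.isSelfAdjoint_iff_isSymmetric]
  intro f g
  simp only [ContinuousLinearMap.coe_coe, sum_apply, sum_inner, inner_sum,
    inner_permL2_left, ← hσ]
  exact Equiv.sum_comp σ (fun i => inner ℂ f (permL2 (τ i) g))

theorem norm_sum_permL2_le {S ι : Type*} [Fintype ι] (τ : ι → Equiv.Perm S) :
    ‖∑ i, permL2 (τ i)‖ ≤ Fintype.card ι := by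
  simpa using norm_sum_le_of_le Finset.univ fun i _ => norm_permL2_le (τ i)

/-- The unit steps of `ℤ^d`. -/
abbrev UnitStep (d : ℕ) := {e : Vtx d // dist1 e 0 = 1}

theorem dist1_neg_zero {d : ℕ} (e : Vtx d) : dist1 (-e) 0 = dist1 e 0 := by
  simp [dist1]

theorem dist1_sub_zero {d : ℕ} (x y : Vtx d) : dist1 (x - y) 0 = dist1 x y := by
  simp [dist1]

theorem setOf_dist1_eq_one_subset (d : ℕ) :
    {e : Vtx d | dist1 e 0 = 1} ⊆
      Set.range fun p : Fin d × Bool => (Pi.single p.1 (if p.2 then 1 else -1) : Vtx d) := by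
  intro e he
  simp only [dist1, Pi.zero_apply, sub_zero, Set.mem_ofPred_eq] at he
  obtain ⟨i, -, hi⟩ : ∃ i ∈ Finset.univ, (e i).natAbs ≠ 0 :=
    Finset.exists_ne_zero_of_sum_ne_zero (by rw [he]; exact one_ne_zero)
  rw [← Finset.add_sum_erase _ _ (Finset.mem_univ i)] at he
  have h0 : ∑ j ∈ Finset.univ.erase i, (e j).natAbs = 0 := by omega
  have h1 : e i = 1 ∨ e i = -1 := by omega
  rw [Finset.sum_eq_zero_iff] at h0
  have hj : ∀ j, j ≠ i → e j = 0 := fun j hj => by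
    simpa using h0 j (by simp [hj])
  refine ⟨(i, decide (e i = 1)), funext fun j => ?_⟩
  by_cases hji : j = i
  · subst hji
    rcases h1 with h | h <;> simp [h]
  · simp [hji, hj j hji]

instance (d : ℕ) : Finite (UnitStep d) :=
  (Set.finite_range _).subset (setOf_dist1_eq_one_subset d)

noncomputable instance (d : ℕ) : Fintype (UnitStep d) := Fintype.ofFinite _

theorem card_unitStep_le (d : ℕ) : Fintype.card (UnitStep d) ≤ 2 * d := by
  rw [← Nat.card_eq_fintype_card]
  calc Nat.card {e : Vtx d | dist1 e 0 = 1}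
      ≤ _ := Nat.card_mono (Set.finite_range _) (setOf_dist1_eq_one_subset d)
    _ ≤ Nat.card (Fin d × Bool) := Finite.card_range_le _
    _ = 2 * d := by simp [mul_comm]

/-- The bijection of `ℤ^d × Perm ℤ^d` that moves the point by `e` and multiplies the permutation
by the transposition of the old and the new point. -/
def stepPerm {d : ℕ} (e : Vtx d) : Equiv.Perm (Vtx d × Equiv.Perm (Vtx d)) where
  toFun s := (s.1 + e, s.2 * Equiv.swap s.1 (s.1 + e))
  invFun s := (s.1 + -e, s.2 * Equiv.swap s.1 (s.1 + -e))
  left_inv s := by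
    ext1
    · simp
    · simp [mul_assoc, Equiv.swap_comm (s.1 + e) s.1]
  right_inv s := by
    ext1
    · simp
    · simp [mul_assoc, Equiv.swap_comm (s.1 + -e) s.1]

theorem stepPerm_neg {d : ℕ} (e : Vtx d) : stepPerm (-e) = (stepPerm e).symm :=
  Equiv.ext fun _ => rfl

theorem isPath_succ_iff {d n : ℕ} (x : Fin (n + 2) → Vtx d) :
    IsPath x ↔ IsPath (Fin.init x) ∧ dist1 (x (Fin.last _)) (x (Fin.last n).castSucc) = 1 :=
  Fin.forall_fin_succ'

theorem transProd_succ {d n : ℕ} (x : Fin (n + 2) → Vtx d) :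
    transProd x =
      transProd (Fin.init x) * Equiv.swap (x (Fin.last n).castSucc) (x (Fin.last _)) := by
  simp only [transProd, List.finRange_succ_last, List.map_append, List.prod_append, List.map_map]
  simp [Function.comp_def, Fin.init]

/-- Evaluating the transposition product at the end point of the path gives its starting point. -/
theorem transProd_apply_last {d n : ℕ} (x : Fin (n + 1) → Vtx d) :
    transProd x (x (Fin.last n)) = x 0 := by
  induction n with
  | zero => simp [transProd]
  | succ n ih =>
    rw [transProd_succ, Equiv.Perm.mul_apply, Equiv.swap_apply_right]
    exact ih (Fin.init x)

/-- Paths of length `n` from the origin with prescribed end point and transposition product. -/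
abbrev PathsTo {d : ℕ} (n : ℕ) (b : Vtx d × Equiv.Perm (Vtx d)) :=
  {x : Fin (n + 1) → Vtx d // IsPath x ∧ x 0 = 0 ∧ (x (Fin.last n), transProd x) = b}

/-- The last step of a path. -/
def PathsTo.lastStep {d n : ℕ} {b : Vtx d × Equiv.Perm (Vtx d)} (x : PathsTo (n + 1) b) :
    UnitStep d :=
  ⟨x.1 (Fin.last _) - x.1 (Fin.last n).castSucc, by
    rw [dist1_sub_zero]; exact ((isPath_succ_iff _).1 x.2.1).2⟩

/-- Removing a given last step from a path. -/
def PathsTo.fiberEquiv {d n : ℕ} (b : Vtx d × Equiv.Perm (Vtx d)) (e : UnitStep d) :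
    {x : PathsTo (n + 1) b // x.lastStep = e} ≃ PathsTo n ((stepPerm e.1).symm b) where
  toFun x := ⟨Fin.init x.1.1, ((isPath_succ_iff _).1 x.1.2.1).1, x.1.2.2.1, by
    obtain ⟨⟨x, hx, h0, rfl⟩, rfl⟩ := x
    rw [Equiv.eq_symm_apply]
    simp [stepPerm, PathsTo.lastStep, transProd_succ, Fin.init]⟩
  invFun y := ⟨⟨Fin.snoc y.1 b.1, by
      obtain ⟨y, hy, h0, h⟩ := y
      rw [Equiv.eq_symm_apply] at h
      subst h
      refine ⟨(isPath_succ_iff _).2 ⟨by simpa using hy, ?_⟩, ?_, ?_⟩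
      · rw [← dist1_sub_zero]
        simpa [stepPerm] using e.2
      · exact (Fin.snoc_castSucc (α := fun _ => Vtx d) _ y 0).trans h0
      · simp [stepPerm, transProd_succ]⟩, by
    obtain ⟨y, hy, h0, h⟩ := y
    rw [Equiv.eq_symm_apply] at h
    subst h
    ext1
    simp [stepPerm, PathsTo.lastStep]⟩
  left_inv x := by
    obtain ⟨⟨x, hx, h0, rfl⟩, rfl⟩ := x
    simp
  right_inv y := by
    simp

/-- Paths of length `n + 1` are paths of length `n` followed by a step. -/
def PathsTo.succEquiv {d : ℕ} (n : ℕ) (b : Vtx d × Equiv.Perm (Vtx d)) :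
    PathsTo (n + 1) b ≃ Σ e : UnitStep d, PathsTo n ((stepPerm e.1).symm b) :=
  (Equiv.sigmaFiberEquiv PathsTo.lastStep).symm.trans
    (Equiv.sigmaCongrRight (PathsTo.fiberEquiv b))

instance PathsTo.finite {d : ℕ} (n : ℕ) (b : Vtx d × Equiv.Perm (Vtx d)) :
    Finite (PathsTo n b) := by
  induction n generalizing b with
  | zero =>
    have : Subsingleton (PathsTo 0 b) := ⟨fun x y => by
      ext i : 2
      rw [Fin.fin_one_eq_zero i, x.2.2.1, y.2.2.1]⟩
    infer_instance
  | succ n ih => exact Finite.of_equiv _ (PathsTo.succEquiv n b).symm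

theorem card_pathsTo_succ {d : ℕ} (n : ℕ) (b : Vtx d × Equiv.Perm (Vtx d)) :
    Nat.card (PathsTo (n + 1) b) =
      ∑ e : UnitStep d, Nat.card (PathsTo n ((stepPerm e.1).symm b)) := by
  rw [Nat.card_congr (PathsTo.succEquiv n b), Nat.card_sigma]

open Classical in
theorem card_pathsTo_zero {d : ℕ} (b : Vtx d × Equiv.Perm (Vtx d)) :
    Nat.card (PathsTo 0 b) = if b = (0, 1) then 1 else 0 := by
  split_ifs with h
  · subst h
    rw [Nat.card_eq_one_iff_unique]
    refine ⟨⟨fun x y => ?_⟩, ⟨⟨fun _ => 0, fun i => i.elim0, rfl, by simp [transProd]⟩⟩⟩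
    ext i : 2
    rw [Fin.fin_one_eq_zero i, x.2.2.1, y.2.2.1]
  · rw [Finite.card_eq_zero_iff]
    refine ⟨fun x => h ?_⟩
    obtain ⟨x, -, h0, rfl⟩ := x
    simp [transProd, h0]

theorem T_eq_card_pathsTo (n d : ℕ) : T n d = Nat.card (PathsTo n ((0, 1) : Vtx d × _)) := by
  refine Nat.card_congr (Equiv.subtypeEquivRight fun x => ?_)
  constructor
  · rintro ⟨hx, h0, -, h⟩
    have := transProd_apply_last x
    rw [h, h0] at this
    exact ⟨hx, h0, Prod.ext this h⟩
  · rintro ⟨hx, h0, h⟩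
    exact ⟨hx, h0, fun _ => trivial, congrArg Prod.snd h⟩

/-- The operator on `ℓ²(ℤ^d × Perm ℤ^d)` whose powers count paths by their end point and
transposition product. -/
noncomputable def walkOperator (d : ℕ) :
    lp (fun _ : Vtx d × Equiv.Perm (Vtx d) => ℂ) 2 →L[ℂ]
      lp (fun _ : Vtx d × Equiv.Perm (Vtx d) => ℂ) 2 :=
  ∑ e : UnitStep d, permL2 (stepPerm e.1)

theorem isSelfAdjoint_walkOperator (d : ℕ) : IsSelfAdjoint (walkOperator d) :=
  isSelfAdjoint_sum_permL2
    ((Equiv.neg (Vtx d)).subtypeEquiv fun e => by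
      rw [Equiv.neg_apply, dist1_neg_zero])
    fun e => stepPerm_neg e.1

theorem norm_walkOperator_le (d : ℕ) : ‖walkOperator d‖ ≤ 2 * d :=
  (norm_sum_permL2_le _).trans (by exact_mod_cast card_unitStep_le d)

theorem walkOperator_apply {d : ℕ} (f : lp (fun _ : Vtx d × Equiv.Perm (Vtx d) => ℂ) 2)
    (b : Vtx d × Equiv.Perm (Vtx d)) :
    walkOperator d f b = ∑ e : UnitStep d, f ((stepPerm e.1).symm b) := by
  simp only [walkOperator, sum_apply, lp.coeFn_sum, Finset.sum_apply, permL2_apply]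

open Classical in
theorem walkOperator_pow_apply (d n : ℕ) (b : Vtx d × Equiv.Perm (Vtx d)) :
    (walkOperator d ^ n) (lp.single 2 (0, 1) 1) b = (Nat.card (PathsTo n b) : ℂ) := by
  induction n generalizing b with
  | zero =>
    rw [card_pathsTo_zero, pow_zero, one_apply_eq_self, lp.single_apply, Pi.single_apply]
    push_cast
    rfl
  | succ n ih =>
    rw [pow_succ', mul_apply_eq_comp, walkOperator_apply, card_pathsTo_succ]
    simp only [ih, Nat.cast_sum]

/-- **Lemma (existence of the integrated density of states of `H[ℤ^d]`).**
For every `d ≥ 1` there is a probability measure on `ℝ` supported in `[−2d, 2d]`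
whose `n`-th moment equals `T_n(d)` for every `n ≥ 0`. -/
theorem umpteen_ids_exists (d : ℕ) (hd : 1 ≤ d) :
    ∃ μ : Measure ℝ, IsProbabilityMeasure μ ∧
      μ (Set.Icc (-(2 * d : ℝ)) (2 * d)) = 1 ∧
      ∀ n : ℕ, ∫ x, x ^ n ∂μ = (T n d : ℝ) := by
  classical
  obtain ⟨μ, hμ, hsupp, hmom⟩ := exists_spectral_measure (isSelfAdjoint_walkOperator d)
    (v := lp.single 2 (0, 1) 1) (by rw [lp.norm_single (by simp), norm_one])
    (norm_walkOperator_le d)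
  refine ⟨μ, hμ, hsupp, fun n => ?_⟩
  rw [hmom, lp.inner_single_left, walkOperator_pow_apply, T_eq_card_pathsTo]
  simp
end

section
/- Let n ≥ 1 and let (x_0, …, x_n) be a path of length n in ℤ (so x_{i+1} − x_i = ±1) with x_0 = 0. Then the transposition product (x_0 x_1)∘(x_1 x_2)∘⋯∘(x_{n−1} x_n) is the identity permutation of ℤ if and only if x_n = 0. Consequently, T_n(1) equals the central binomial coefficient C(n, n/2) when n is even, and equals 0 when n is odd. -/
open scoped BigOperators

/-- `x : Fin (n+1) → ℤ` is a path of length `n` in `ℤ` (steps of size one). -/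
def IsPathZ {n : ℕ} (x : Fin (n + 1) → ℤ) : Prop :=
  ∀ i : Fin n, (x i.succ - x i.castSucc).natAbs = 1

/-- The transposition product `(x₀ x₁)∘(x₁ x₂)∘⋯∘(x_{n-1} x_n)` of a path in `ℤ`. -/
def transProdZ {n : ℕ} (x : Fin (n + 1) → ℤ) : Equiv.Perm ℤ :=
  ((List.finRange n).map (fun i => Equiv.swap (x i.castSucc) (x i.succ))).prod

/-- `T_n(1)`: the number of paths of length `n` in `ℤ` starting at `0` with identity
transposition product. -/
noncomputable def T1 (n : ℕ) : ℕ :=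
  Nat.card {x : Fin (n + 1) → ℤ // IsPathZ x ∧ x 0 = 0 ∧ transProdZ x = 1}

/-- Telescoping sum of a finite integer sequence. -/
theorem sum_succ_sub_castSucc {n : ℕ} (x : Fin (n + 1) → ℤ) :
    ∑ i : Fin n, (x i.succ - x i.castSucc) = x (Fin.last n) - x 0 := by
  induction n with
  | zero => simp
  | succ n ih =>
    have h := ih fun i => x i.castSucc
    rw [Fin.sum_univ_castSucc]
    simp only [Fin.succ_castSucc, Fin.succ_last] at h ⊢
    rw [h, Fin.castSucc_zero]
    ring

theorem IsPathZ.tail {n : ℕ} {x : Fin (n + 2) → ℤ} (hx : IsPathZ x) :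
    IsPathZ fun i : Fin (n + 1) => x i.succ := fun i => hx i.succ

theorem transProdZ_succ {n : ℕ} (x : Fin (n + 2) → ℤ) :
    transProdZ x = Equiv.swap (x 0) (x 1) * transProdZ fun i : Fin (n + 1) => x i.succ := by
  simp [transProdZ, List.finRange_succ, Function.comp_def]

/-- The transposition product carries the endpoint of a path to its starting point. -/
theorem transProdZ_apply_last {n : ℕ} (x : Fin (n + 1) → ℤ) :
    transProdZ x (x (Fin.last n)) = x 0 := by
  induction n with
  | zero => simp [transProdZ]
  | succ n ih =>
    have h := ih fun i => x i.succ
    rw [Fin.succ_last] at h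
    simp [transProdZ_succ, h]

/-- Potential on `ℤ` whose increments are the adjacent transpositions. -/
theorem exists_potential_swap : ∃ C : ℤ → Equiv.Perm ℤ,
    ∀ a, C (a + 1) = C a * Equiv.swap a (a + 1) := by
  let F : ℕ → Equiv.Perm ℤ := fun n =>
    n.rec 1 fun (k : ℕ) p => p * Equiv.swap (k : ℤ) (k + 1)
  let G : ℕ → Equiv.Perm ℤ := fun n =>
    n.rec 1 fun (k : ℕ) p => p * Equiv.swap (-k - 1 : ℤ) (-k)
  refine ⟨fun a => F a.toNat * G (-a).toNat, fun a => ?_⟩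
  rcases le_or_gt 0 a with ha | ha
  · lift a to ℕ using ha
    have h₁ : ((a : ℤ) + 1).toNat = a + 1 := by omega
    have h₂ : (-((a : ℤ) + 1)).toNat = 0 := by omega
    have h₃ : (-(a : ℤ)).toNat = 0 := by omega
    simp only [h₁, h₂, h₃]
    simp [F, G]
  · obtain ⟨k, rfl⟩ : ∃ k : ℕ, a = -(k : ℤ) - 1 := ⟨(-a - 1).toNat, by omega⟩
    have h₁ : (-(k : ℤ) - 1 + 1).toNat = 0 := by omega
    have h₂ : (-(-(k : ℤ) - 1 + 1)).toNat = k := by omega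
    have h₃ : (-(k : ℤ) - 1).toNat = 0 := by omega
    have h₄ : (-(-(k : ℤ) - 1)).toNat = k + 1 := by omega
    simp only [h₁, h₂, h₃, h₄]
    simp [F, G, mul_assoc]

theorem IsPathZ.potential_mul_transProdZ {C : ℤ → Equiv.Perm ℤ}
    (hC : ∀ a, C (a + 1) = C a * Equiv.swap a (a + 1)) {n : ℕ} {x : Fin (n + 1) → ℤ}
    (hx : IsPathZ x) : C (x 0) * transProdZ x = C (x (Fin.last n)) := by
  induction n with
  | zero => simp [transProdZ]
  | succ n ih =>
    have h := ih hx.tail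
    have hstep : C (x 0) * Equiv.swap (x 0) (x 1) = C (x 1) := by
      have h₁ : (x 1 - x 0).natAbs = 1 := hx 0
      rcases Int.natAbs_eq_iff.mp h₁ with h₁ | h₁
      · rw [show x 1 = x 0 + 1 by push_cast at h₁; omega, hC]
      · rw [show x 0 = x 1 + 1 by push_cast at h₁; omega, hC, mul_assoc,
          Equiv.swap_comm (x 1 + 1), Equiv.swap_mul_self, mul_one]
    rw [transProdZ_succ, ← mul_assoc, hstep]
    simpa using h

theorem IsPathZ.transProdZ_eq_one_iff {n : ℕ} {x : Fin (n + 1) → ℤ} (hx : IsPathZ x) :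
    transProdZ x = 1 ↔ x (Fin.last n) = x 0 := by
  constructor
  · intro h
    simpa [h] using transProdZ_apply_last x
  · intro h
    obtain ⟨C, hC⟩ := exists_potential_swap
    have := hx.potential_mul_transProdZ hC
    rw [h] at this
    exact mul_eq_left.mp this

/-- The set of times at which a path steps up. -/
def upSteps {n : ℕ} (x : Fin (n + 1) → ℤ) : Finset (Fin n) :=
  {i | x i.succ - x i.castSucc = 1}

theorem IsPathZ.step_eq {n : ℕ} {x : Fin (n + 1) → ℤ} (hx : IsPathZ x) (i : Fin n) :
    x i.succ - x i.castSucc = if i ∈ upSteps x then 1 else -1 := by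
  have := hx i
  simp only [upSteps, Finset.mem_filter_univ]
  split_ifs <;> omega

theorem IsPathZ.last_sub_zero {n : ℕ} {x : Fin (n + 1) → ℤ} (hx : IsPathZ x) :
    x (Fin.last n) - x 0 = 2 * (upSteps x).card - n := by
  have h (i : Fin n) : x i.succ - x i.castSucc = 2 * (if i ∈ upSteps x then 1 else 0) - 1 := by
    rw [hx.step_eq]
    split_ifs <;> norm_num
  simp [← sum_succ_sub_castSucc, h, mul_comm]

theorem IsPathZ.eq_of_upSteps_eq {n : ℕ} {x y : Fin (n + 1) → ℤ} (hx : IsPathZ x)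
    (hy : IsPathZ y) (h0 : x 0 = y 0) (h : upSteps x = upSteps y) : x = y := by
  funext i
  induction i using Fin.induction with
  | zero => exact h0
  | succ i ih =>
    have h₁ := hx.step_eq i
    have h₂ := hy.step_eq i
    rw [h] at h₁
    omega

theorem exists_isPathZ_upSteps_eq {n : ℕ} (S : Finset (Fin n)) :
    ∃ x : Fin (n + 1) → ℤ, IsPathZ x ∧ x 0 = 0 ∧ upSteps x = S := by
  let f : Fin n → ℤ := fun i => if i ∈ S then 1 else -1
  have h (i : Fin n) :
      Fin.partialSum f i.succ - Fin.partialSum f i.castSucc = if i ∈ S then 1 else -1 := by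
    rw [Fin.partialSum_succ, add_sub_cancel_left]
  refine ⟨Fin.partialSum f, fun i => ?_, Fin.partialSum_zero f, ?_⟩
  · rw [h]
    split_ifs <;> rfl
  · ext i
    rw [upSteps, Finset.mem_filter_univ, h]
    split_ifs with hi <;> simp [hi]

theorem T1_eq_card (n : ℕ) : T1 n = Nat.card {S : Finset (Fin n) // 2 * S.card = n} := by
  refine Nat.card_eq_of_bijective
    (fun x => ⟨upSteps x.1, ?_⟩) ⟨fun x y hxy => ?_, fun S => ?_⟩
  · obtain ⟨x, hx, h0, h⟩ := x
    have := hx.last_sub_zero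
    rw [hx.transProdZ_eq_one_iff] at h
    dsimp only
    omega
  · exact Subtype.ext <| x.2.1.eq_of_upSteps_eq y.2.1 (x.2.2.1.trans y.2.2.1.symm)
      (congrArg Subtype.val hxy)
  · obtain ⟨S, hS⟩ := S
    obtain ⟨x, hx, h0, rfl⟩ := exists_isPathZ_upSteps_eq S
    have := hx.last_sub_zero
    exact ⟨⟨x, hx, h0, hx.transProdZ_eq_one_iff.mpr (by omega)⟩, rfl⟩

theorem T1_eq (n : ℕ) : T1 n = if Even n then n.choose (n / 2) else 0 := by
  rw [T1_eq_card]
  split_ifs with hn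
  · have h (S : Finset (Fin n)) : 2 * S.card = n ↔ S.card = n / 2 := by
      have := Nat.two_mul_div_two_of_even hn
      omega
    simp only [h, Nat.card_eq_fintype_card]
    rw [Fintype.card_finset_len, Fintype.card_fin]
  · have : IsEmpty {S : Finset (Fin n) // 2 * S.card = n} :=
      ⟨fun S => hn (S.2 ▸ even_two_mul _)⟩
    exact Nat.card_of_isEmpty

/-- **Lemma (the one-dimensional case is trivial).**
For a path of length `n ≥ 1` in `ℤ` starting at `0`, the transposition product is the
identity iff the path ends at `0`; consequently `T_n(1) = C(n, n/2)` for even `n` and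
`T_n(1) = 0` for odd `n`. -/
theorem umpteen_one_dimensional (n : ℕ) (hn : 1 ≤ n)
    (x : Fin (n + 1) → ℤ) (hx : IsPathZ x) (h0 : x 0 = 0) :
    (transProdZ x = 1 ↔ x (Fin.last n) = 0) ∧
      T1 n = if Even n then n.choose (n / 2) else 0 :=
  ⟨h0 ▸ hx.transProdZ_eq_one_iff, T1_eq n⟩
end

section
/- For every even integer n ≥ 0, the limit as N → ∞ of N^{−n/2} times the number of sequences (y_0, y_1, …, y_n) of elements of {1, …, N} with y_0 = 1, with y_{i+1} ≠ y_i for all 0 ≤ i < n, and with (y_0 y_1)∘(y_1 y_2)∘⋯∘(y_{n−1} y_n) equal to the identity permutation of {1, …, N}, exists and equals n! / ((n/2)! · ((n/2) + 1)!). -/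
open scoped BigOperators
open Filter

/-- The transposition product `(y₀ y₁)∘(y₁ y₂)∘⋯∘(y_{n-1} y_n)` of a sequence in the
vertex set `Fin N` of the complete graph `K_N`. -/
def transProdK {N n : ℕ} (y : Fin (n + 1) → Fin N) : Equiv.Perm (Fin N) :=
  ((List.finRange n).map (fun i => Equiv.swap (y i.castSucc) (y i.succ))).prod

/-- The number of closed walks of length `n` in the complete graph `K_N` starting at
the vertex `0` (playing the rôle of `1 ∈ {1, …, N}`) whose transposition product is the
identity. -/
noncomputable def kCount (n N : ℕ) : ℕ :=
  Nat.card {y : Fin (n + 1) → Fin N //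
    (y 0 : ℕ) = 0 ∧ (∀ i : Fin n, y i.succ ≠ y i.castSucc) ∧ transProdK y = 1}

/-- The number of walks of length `n` from `c` whose transposition product `h` satisfies
`g * h = 1`. -/
def closingCount {α : Type*} [Fintype α] [DecidableEq α] : ℕ → α → Equiv.Perm α → ℕ
  | 0, _, g => if g = 1 then 1 else 0
  | n + 1, c, g => ∑ v ∈ Finset.univ.erase c, closingCount n v (g * Equiv.swap c v)

/-- The transposition product of a walk recorded as a list with the latest vertex first. -/
def walkProd {α : Type*} [DecidableEq α] : List α → Equiv.Perm α
  | [] => 1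
  | [_] => 1
  | v :: c :: r => walkProd (c :: r) * Equiv.swap c v

/-- `closingCount` for the continuations of a walk, latest vertex first. -/
def walkClosingCount {α : Type*} [Fintype α] [DecidableEq α] (n : ℕ) : List α → ℕ
  | [] => 0
  | c :: r => closingCount n c (walkProd (c :: r))

/-- The vertices by which a walk can be extended without backtracking. -/
def extensions {α : Type*} [Fintype α] [DecidableEq α] : List α → Finset α
  | [] => ∅
  | [c] => Finset.univ.erase c
  | c :: p :: _ => (Finset.univ.erase c).erase p

/-- The non-backtracking walks of length `l` from `o`, latest vertex first. -/
def reducedWalks {α : Type*} [Fintype α] [DecidableEq α] (o : α) : ℕ → Finset (List α)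
  | 0 => {[o]}
  | l + 1 => (reducedWalks o l).biUnion fun s => (extensions s).image (· :: s)

/-- The closing counts summed over all non-backtracking walks of length `l`. -/
def reducedSum {α : Type*} [Fintype α] [DecidableEq α] (o : α) (n l : ℕ) : ℕ :=
  ∑ s ∈ reducedWalks o l, walkClosingCount n s

/-- The number of nonnegative lattice paths of length `n` with `±1` steps from `l` to `0`. -/
def ballot : ℕ → ℕ → ℕ
  | 0, 0 => 1
  | 0, _ + 1 => 0
  | n + 1, 0 => ballot n 1
  | n + 1, l + 1 => ballot n l + ballot n (l + 2)

theorem ballot_eq_zero_of_lt {n l : ℕ} (h : n < l) : ballot n l = 0 := by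
  induction n generalizing l with
  | zero => obtain ⟨l, rfl⟩ := Nat.exists_eq_succ_of_ne_zero h.ne'; rfl
  | succ n ih =>
    obtain ⟨l, rfl⟩ := Nat.exists_eq_succ_of_ne_zero (by omega : l ≠ 0)
    simp [ballot, ih (l := l) (by omega), ih (l := l + 2) (by omega)]

theorem ballot_mul_factorial (n l k : ℕ) (h : n = l + 2 * k) :
    ballot n l * (k.factorial * (l + k + 1).factorial) = (l + 1) * n.factorial := by
  induction n generalizing l k with
  | zero =>
    obtain rfl : l = 0 := by omega
    obtain rfl : k = 0 := by omega
    rfl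
  | succ n ih =>
    rcases l with _ | l
    · obtain ⟨k, rfl⟩ : ∃ j, k = j + 1 := ⟨k - 1, by omega⟩
      have e := ih 1 k (by omega)
      have hn : n + 1 = 2 * (k + 1) := by omega
      rw [show 1 + k + 1 = 0 + (k + 1) + 1 by ring] at e
      simp only [ballot, Nat.factorial_succ k, Nat.factorial_succ n]
      rw [hn]
      linear_combination (k + 1) * e
    · have e1 := ih l k (by omega)
      have f1 : (l + 1 + k + 1).factorial = (l + k + 2) * (l + k + 1).factorial := by
        rw [show l + 1 + k + 1 = (l + k + 1) + 1 by ring, Nat.factorial_succ]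
      rcases k with _ | k
      · have hn : n = l := by omega
        subst hn
        simp only [ballot, ballot_eq_zero_of_lt (show n < n + 2 by omega),
          Nat.factorial_succ n, f1]
        simp only [add_zero, Nat.factorial_succ n] at e1 ⊢
        linear_combination (n + 2) * e1
      · have e2 := ih (l + 2) k (by omega)
        have f2 : l + 2 + k + 1 = l + 1 + (k + 1) + 1 := by ring
        rw [f2, f1] at e2
        have hn : n + 1 = l + 1 + 2 * (k + 1) := h
        simp only [ballot, Nat.factorial_succ n, f1]
        rw [hn]
        have f3 := Nat.factorial_succ k
        linear_combination (l + (k + 1) + 2) * e1 + (k + 1) * e2 +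
          ballot n (l + 2) * (l + (k + 1) + 2) * (l + (k + 1) + 1).factorial * f3

/-- No two consecutive vertices of a walk are equal, and the walk never backtracks. -/
def IsNonBacktracking {α : Type*} : List α → Prop
  | [] => True
  | [_] => True
  | [a, b] => a ≠ b
  | a :: b :: c :: r => a ≠ b ∧ a ≠ c ∧ IsNonBacktracking (b :: c :: r)

theorem IsNonBacktracking.tail {α : Type*} {a : α} {s : List α} (h : IsNonBacktracking (a :: s)) : IsNonBacktracking s := by
  match s, h with
  | [], _ => trivial
  | [_], _ => trivial
  | _ :: _ :: _, h => exact h.2.2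

theorem exists_factor_of_card_le {α : Type*} (o : α) (S : Finset α) (m : ℕ) (h : S.card ≤ m) :
    ∃ g : Fin m → α, ∀ x ∈ S, ∃ i, g i = x := by
  classical
  obtain ⟨e⟩ : Nonempty (S ↪ Fin m) := Function.Embedding.nonempty_of_card_le (by simpa using h)
  refine ⟨Function.extend e Subtype.val fun _ => o, fun x hx => ⟨e ⟨x, hx⟩, ?_⟩⟩
  rw [e.injective.extend_apply]

section Walks

variable {α : Type*} [DecidableEq α]

theorem walkProd_apply_head (c : α) (r : List α) (o : α) (h : (c :: r).getLast? = some o) :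
    walkProd (c :: r) c = o := by
  induction r generalizing c with
  | nil => simpa [walkProd] using h
  | cons b r ih =>
    rw [List.getLast?_cons_cons] at h
    simpa [walkProd] using ih b h

theorem walkProd_apply_of_notMem {x : α} (s : List α) (h : x ∉ s) : walkProd s x = x := by
  fun_induction walkProd s with
  | case1 => rfl
  | case2 => rfl
  | case3 v c r ih =>
    simp only [List.mem_cons, not_or] at h ih
    simp [Equiv.swap_apply_of_ne_of_ne h.2.1 h.1, ih h.2]

theorem walkProd_apply_ne {x o : α} (v : α) (s : List α) (hs : IsNonBacktracking (v :: s))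
    (hc : (v :: s).count x = 1) (hv : x ≠ v) (hl : (v :: s).getLast? = some o) (ho : x ≠ o) :
    walkProd (v :: s) x ≠ x := by
  induction s generalizing v with
  | nil => simp [hv.symm] at hc
  | cons c r ih =>
    rw [List.getLast?_cons_cons] at hl
    rw [List.count_cons_of_ne hv.symm] at hc
    by_cases hx : c = x
    · subst hx
      rcases r with _ | ⟨b, r⟩
      · simp at hl; exact absurd hl ho
      · have hm : c ∉ b :: r := by
          rw [List.count_cons_self] at hc
          exact List.count_eq_zero.mp (by omega)
        have hb : v ≠ b := hs.2.1
        intro e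
        simp only [walkProd, Equiv.Perm.mul_apply, Equiv.swap_apply_left,
          Equiv.swap_apply_of_ne_of_ne hb hv.symm] at e
        have := (walkProd (b :: r)).injective (e.trans (walkProd_apply_of_notMem _ hm).symm)
        exact hv this.symm
    · have := ih c hs.tail hc (Ne.symm hx) hl
      simpa [walkProd, Equiv.swap_apply_of_ne_of_ne (Ne.symm hx) hv] using this

theorem two_le_count_of_walkProd_eq_one {o x : α} (v c : α) (r : List α)
    (hs : IsNonBacktracking (v :: c :: r)) (hl : (v :: c :: r).getLast? = some o)
    (h1 : walkProd (v :: c :: r) = 1) (hx : x ∈ v :: c :: r) :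
    2 ≤ (v :: c :: r).count x := by
  have hv : v = o := by simpa [h1] using walkProd_apply_head v _ o hl
  subst hv
  by_cases hxv : x = v
  · subst hxv
    rw [List.getLast?_cons_cons] at hl
    have := List.count_pos_iff.mpr (List.mem_of_getLast? hl)
    rw [List.count_cons_self]
    omega
  · have := List.count_pos_iff.mpr hx
    by_contra hlt
    exact walkProd_apply_ne v _ hs (by omega) hxv hl hxv (by simp [h1])

theorem two_mul_card_toFinset_le {s : List α} (h : ∀ x ∈ s, 2 ≤ s.count x) :
    2 * s.toFinset.card ≤ s.length := by
  rw [← List.sum_toFinset_count_eq_length, mul_comm, ← smul_eq_mul]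
  exact Finset.card_nsmul_le_sum _ _ _ fun x hx => h x (List.mem_toFinset.mp hx)

variable [Fintype α]

theorem mem_reducedWalks {o : α} {l : ℕ} {s : List α} (h : s ∈ reducedWalks o l) :
    IsNonBacktracking s ∧ s.length = l + 1 ∧ s.getLast? = some o := by
  induction l generalizing s with
  | zero =>
    obtain rfl : s = [o] := by simpa [reducedWalks] using h
    exact ⟨trivial, rfl, rfl⟩
  | succ l ih =>
    simp only [reducedWalks, Finset.mem_biUnion, Finset.mem_image] at h
    obtain ⟨t, ht, v, hv, rfl⟩ := h
    obtain ⟨h1, h2, h3⟩ := ih ht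
    refine ⟨?_, by simp [h2], ?_⟩
    · match t, h1, hv with
      | [], _, _ => trivial
      | [c], _, hv => simpa [extensions, IsNonBacktracking] using hv
      | c :: p :: r, h1, hv =>
        simp only [extensions, Finset.mem_erase, Finset.mem_univ, and_true] at hv
        exact ⟨hv.2, hv.1, h1⟩
    · rcases t with _ | ⟨c, r⟩
      · simp at h2
      · rwa [List.getLast?_cons_cons]

theorem sum_reducedWalks_succ (o : α) (l : ℕ) (f : List α → ℕ) :
    ∑ s ∈ reducedWalks o (l + 1), f s =
      ∑ s ∈ reducedWalks o l, ∑ v ∈ extensions s, f (v :: s) := by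
  rw [reducedWalks, Finset.sum_biUnion]
  · exact Finset.sum_congr rfl fun s _ => Finset.sum_image fun a _ b _ h => (List.cons.inj h).1
  · intro s _ t _ hst
    rw [Function.onFun, Finset.disjoint_left]
    intro w hw hw'
    obtain ⟨a, _, rfl⟩ := Finset.mem_image.mp hw
    obtain ⟨b, _, hb⟩ := Finset.mem_image.mp hw'
    exact hst (List.cons.inj hb).2.symm

theorem card_extensions {o : α} {l : ℕ} {s : List α} (h : s ∈ reducedWalks o l) :
    (extensions s).card = Fintype.card α - if l = 0 then 1 else 2 := by
  obtain ⟨h1, h2, -⟩ := mem_reducedWalks h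
  match s, h1, h2 with
  | [c], _, h2 =>
    obtain rfl : l = 0 := by simpa using h2
    simp [extensions]
  | c :: p :: r, h1, h2 =>
    have hl : l ≠ 0 := by simp at h2; omega
    have hp : p ∈ Finset.univ.erase c := by
      rcases r with _ | ⟨q, r⟩
      · simpa using (show c ≠ p from h1).symm
      · simpa using h1.1.symm
    simp [extensions, hl, Finset.card_erase_of_mem hp]
    omega

theorem reducedSum_succ_zero (o : α) (n : ℕ) : reducedSum o (n + 1) 0 = reducedSum o n 1 := by
  rw [reducedSum, reducedSum, sum_reducedWalks_succ]
  simp [reducedWalks, walkClosingCount, closingCount, extensions, walkProd]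

theorem walkClosingCount_succ (n : ℕ) (c p : α) (r : List α) (h : c ≠ p) :
    walkClosingCount (n + 1) (c :: p :: r) = walkClosingCount n (p :: r) +
      ∑ v ∈ extensions (c :: p :: r), walkClosingCount n (v :: c :: p :: r) := by
  have hp : p ∈ Finset.univ.erase c := by simpa using h.symm
  simp only [walkClosingCount, closingCount, extensions]
  rw [← Finset.add_sum_erase _ _ hp]
  simp [walkProd, mul_assoc, Equiv.swap_comm c p]

theorem reducedSum_succ_succ (o : α) (n l : ℕ) :
    reducedSum o (n + 1) (l + 1) =
      (Fintype.card α - if l = 0 then 1 else 2) * reducedSum o n l + reducedSum o n (l + 2) := by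
  have key : ∀ s ∈ reducedWalks o (l + 1), walkClosingCount (n + 1) s =
      walkClosingCount n s.tail + ∑ v ∈ extensions s, walkClosingCount n (v :: s) := by
    intro s hs
    obtain ⟨h1, h2, -⟩ := mem_reducedWalks hs
    match s, h1, h2 with
    | [c, p], h1, _ => exact walkClosingCount_succ n c p [] h1
    | c :: p :: q :: r, h1, _ => exact walkClosingCount_succ n c p (q :: r) h1.1
  rw [reducedSum, Finset.sum_congr rfl key, Finset.sum_add_distrib, ← sum_reducedWalks_succ,
    sum_reducedWalks_succ, reducedSum, reducedSum, Finset.mul_sum]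
  congr 1
  refine Finset.sum_congr rfl fun s hs => ?_
  simp [card_extensions hs]

theorem reducedSum_zero_le (o : α) (l : ℕ) :
    reducedSum o 0 (l + 1) ≤ (Fintype.card α) ^ (l / 2) * (l / 2 + 1) ^ (l + 2) := by
  have hsum : reducedSum o 0 (l + 1) =
      ((reducedWalks o (l + 1)).filter fun s => walkProd s = 1).card := by
    rw [reducedSum, Finset.card_filter]
    refine Finset.sum_congr rfl fun s hs => ?_
    obtain ⟨-, h2, -⟩ := mem_reducedWalks hs
    match s, h2 with
    | c :: r, _ => rfl
  let F : (Fin (l / 2) → α) × (Fin (l + 2) → Option (Fin (l / 2))) → List α :=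
    fun p => List.ofFn fun i => (p.2 i).elim o p.1
  have hsub : ((reducedWalks o (l + 1)).filter fun s => walkProd s = 1) ⊆
      Finset.univ.image F := by
    intro s hs
    obtain ⟨hs, h1⟩ := Finset.mem_filter.mp hs
    obtain ⟨hr, hlen, hlast⟩ := mem_reducedWalks hs
    have hcount : ∀ x ∈ s, 2 ≤ s.count x := by
      match s, hlen with
      | v :: c :: r, _ => exact fun x hx => two_le_count_of_walkProd_eq_one v c r hr hlast h1 hx
    have hcard := two_mul_card_toFinset_le hcount
    have ho : o ∈ s.toFinset := List.mem_toFinset.mpr (List.mem_of_getLast? hlast)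
    obtain ⟨g, hg⟩ := exists_factor_of_card_le o (s.toFinset.erase o) (l / 2) (by
      rw [Finset.card_erase_of_mem ho]; omega)
    have hh : ∀ i : Fin (l + 2), ∃ j : Option (Fin (l / 2)),
        j.elim o g = s.get (i.cast hlen.symm) := by
      intro i
      by_cases hi : s.get (i.cast hlen.symm) = o
      · exact ⟨none, hi.symm⟩
      · obtain ⟨j, hj⟩ := hg _ (Finset.mem_erase.mpr
          ⟨hi, List.mem_toFinset.mpr (List.get_mem s _)⟩)
        exact ⟨some j, hj⟩
    choose h hh using hh
    refine Finset.mem_image.mpr ⟨(g, h), Finset.mem_univ _, ?_⟩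
    simp only [F, hh]
    apply List.ext_get
    · simp [hlen]
    · intro i _ _
      simp only [List.get_eq_getElem, List.getElem_ofFn, Fin.val_cast]
  rw [hsum]
  refine (Finset.card_le_card hsub).trans (Finset.card_image_le.trans ?_)
  simp

end Walks

theorem transProdK_cons {N n : ℕ} (c : Fin N) (y : Fin (n + 1) → Fin N) :
    transProdK (Fin.cons c y : Fin (n + 2) → Fin N) = Equiv.swap c (y 0) * transProdK y := by
  simp only [transProdK, List.finRange_succ, List.map_cons, List.map_map, List.prod_cons]
  rfl

theorem closingCount_eq_card {N : ℕ} (n : ℕ) (c : Fin N) (g : Equiv.Perm (Fin N)) :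
    closingCount n c g = (Finset.univ.filter fun y : Fin (n + 1) → Fin N =>
      y 0 = c ∧ (∀ i : Fin n, y i.succ ≠ y i.castSucc) ∧ g * transProdK y = 1).card := by
  induction n generalizing c g with
  | zero =>
    rw [closingCount]
    have : ∀ y : Fin 1 → Fin N, transProdK y = 1 := fun y => rfl
    split_ifs with hg
    · rw [eq_comm, Finset.card_eq_one]
      refine ⟨fun _ => c, ?_⟩
      ext y
      simp [this, hg, funext_iff, Fin.forall_fin_one]
    · simp [this, hg]
  | succ n ih =>
    rw [closingCount, Finset.sum_congr rfl fun v _ => ih v _,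
      ← Finset.sum_congr rfl fun v _ => Finset.card_image_of_injective _
        (Fin.cons_right_injective (α := fun _ : Fin (n + 2) => Fin N) c),
      ← Finset.card_biUnion]
    · congr 1
      ext y
      simp only [Finset.mem_biUnion, Finset.mem_image, Finset.mem_filter, Finset.mem_univ,
        true_and, Finset.mem_erase, and_true]
      constructor
      · rintro ⟨v, hv, z, ⟨rfl, hz, hp⟩, rfl⟩
        refine ⟨rfl, Fin.cases hv hz, ?_⟩
        rw [transProdK_cons, ← mul_assoc, hp]
      · rintro ⟨rfl, hy, hp⟩
        refine ⟨y 1, hy 0, Fin.tail y, ⟨rfl, fun i => hy i.succ, ?_⟩, Fin.cons_self_tail y⟩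
        rw [← Fin.cons_self_tail y, transProdK_cons, ← mul_assoc] at hp
        exact hp
    · intro v _ w _ hvw
      rw [Function.onFun, Finset.disjoint_left]
      intro y hy hy'
      simp only [Finset.mem_image, Finset.mem_filter, Finset.mem_univ, true_and] at hy hy'
      obtain ⟨z, ⟨hz, -⟩, rfl⟩ := hy
      obtain ⟨z', ⟨hz', -⟩, h⟩ := hy'
      have := Fin.cons_right_injective (α := fun _ : Fin (n + 2) => Fin N) c h
      exact hvw (by rw [← hz, ← hz', this])

theorem kCount_succ_eq_reducedSum (n N : ℕ) :
    kCount n (N + 1) = reducedSum (0 : Fin (N + 1)) n 0 := by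
  simp only [reducedSum, reducedWalks, Finset.sum_singleton, walkClosingCount, walkProd]
  rw [closingCount_eq_card, kCount, Nat.card_eq_fintype_card, Fintype.card_subtype]
  congr 1
  ext y
  have h0 : (y 0 : ℕ) = 0 ↔ y 0 = 0 := by rw [Fin.ext_iff, Fin.val_zero]
  simp only [Finset.mem_filter, Finset.mem_univ, true_and, one_mul, h0]

theorem tendsto_reducedSum_div_zero (l : ℕ) :
    Tendsto (fun N : ℕ => (reducedSum (0 : Fin (N + 1)) 0 l : ℝ) / √((N : ℝ) + 1) ^ l)
      atTop (nhds (ballot 0 l)) := by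
  rcases l with _ | l
  · simp [reducedSum, reducedWalks, walkClosingCount, walkProd, closingCount, ballot]
  · have hs : Tendsto (fun N : ℕ => √((N : ℝ) + 1)) atTop atTop :=
      Real.tendsto_sqrt_atTop.comp (tendsto_atTop_add_const_right _ _ tendsto_natCast_atTop_atTop)
    have hz : Tendsto (fun N : ℕ => ((l / 2 : ℕ) + 1 : ℝ) ^ (l + 2) / √((N : ℝ) + 1))
        atTop (nhds 0) := hs.const_div_atTop _
    simp only [ballot, Nat.cast_zero]
    refine squeeze_zero (fun N => by positivity) (fun N => ?_) hz
    have hx : 1 ≤ √((N : ℝ) + 1) := Real.one_le_sqrt.mpr (by simp)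
    have hsq : √((N : ℝ) + 1) ^ 2 = N + 1 := Real.sq_sqrt (by positivity)
    have hle : (reducedSum (0 : Fin (N + 1)) 0 (l + 1) : ℝ) ≤
        (N + 1 : ℝ) ^ (l / 2) * ((l / 2 : ℕ) + 1 : ℝ) ^ (l + 2) := by
      have := reducedSum_zero_le (0 : Fin (N + 1)) l
      rw [Fintype.card_fin] at this
      exact_mod_cast this
    rw [div_le_div_iff₀ (by positivity) (by positivity)]
    have hpow : (N + 1 : ℝ) ^ (l / 2) ≤ √((N : ℝ) + 1) ^ l := by
      calc (N + 1 : ℝ) ^ (l / 2) = √((N : ℝ) + 1) ^ (2 * (l / 2)) := by rw [pow_mul, hsq]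
        _ ≤ _ := pow_le_pow_right₀ hx (Nat.mul_div_le l 2)
    calc _ ≤ √((N : ℝ) + 1) ^ l * ((l / 2 : ℕ) + 1 : ℝ) ^ (l + 2) * √((N : ℝ) + 1) := by
          gcongr
          exact hle.trans (by gcongr)
      _ = _ := by ring

theorem tendsto_reducedSum_div (n l : ℕ) :
    Tendsto (fun N : ℕ => (reducedSum (0 : Fin (N + 1)) n l : ℝ) / √((N : ℝ) + 1) ^ (n + l))
      atTop (nhds (ballot n l)) := by
  induction n generalizing l with
  | zero => simpa using tendsto_reducedSum_div_zero l
  | succ n ih =>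
    rcases l with _ | l
    · simpa [reducedSum_succ_zero, ballot] using ih 1
    · have hd : Tendsto (fun N : ℕ => ((N + 1 - if l = 0 then 1 else 2 : ℕ) : ℝ) / (N + 1))
          atTop (nhds 1) := by
        generalize (if l = 0 then 1 else 2) = d
        have h0 : Tendsto (fun N : ℕ => 1 - (d : ℝ) / (N + 1)) atTop (nhds (1 - 0)) :=
          tendsto_const_nhds.sub ((tendsto_atTop_add_const_right _ _
            tendsto_natCast_atTop_atTop).const_div_atTop _)
        rw [sub_zero] at h0
        refine h0.congr' ?_
        filter_upwards [eventually_ge_atTop d] with N hN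
        have : (N : ℝ) + 1 ≠ 0 := by positivity
        rw [Nat.cast_sub (by omega)]
        push_cast
        field_simp
      have h := (hd.mul (ih l)).add (ih (l + 2))
      simp only [ballot, Nat.cast_add]
      rw [one_mul] at h
      refine h.congr fun N => ?_
      have hx : 0 < √((N : ℝ) + 1) := by positivity
      have hsq : (N : ℝ) + 1 = √((N : ℝ) + 1) ^ 2 := (Real.sq_sqrt (by positivity)).symm
      rw [reducedSum_succ_succ, Fintype.card_fin, Nat.cast_add, Nat.cast_mul, add_div,
        show n + 1 + (l + 1) = 2 + (n + l) by ring, pow_add _ 2, ← hsq, mul_div_mul_comm,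
        show n + (l + 2) = 2 + (n + l) by ring, pow_add _ 2, ← hsq]

/-- **Lemma (semicircular moments for the complete graph).**
For every even `n`, `N^{-n/2}` times the number of closed walks of length `n` in `K_N`
starting at a fixed vertex with trivial transposition product converges, as `N → ∞`,
to the Catalan number `n!/((n/2)!·((n/2)+1)!)`. -/
theorem umpteen_complete_graph_moments (n : ℕ) (hn : Even n) :
    Tendsto (fun N : ℕ => (kCount n N : ℝ) / (N : ℝ) ^ (n / 2))
      atTop
      (nhds ((n.factorial : ℝ) / ((n / 2).factorial * ((n / 2) + 1).factorial))) := by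
  obtain ⟨k, rfl⟩ := hn
  have hk : (k + k) / 2 = k := by omega
  rw [hk]
  have hb := ballot_mul_factorial (k + k) 0 k (by ring)
  have hval : ((k + k).factorial : ℝ) / (k.factorial * (k + 1).factorial) =
      ballot (k + k) 0 := by
    rw [div_eq_iff (by positivity)]
    simp only [zero_add, one_mul] at hb
    exact_mod_cast hb.symm
  rw [hval, ← tendsto_add_atTop_iff_nat 1]
  refine (tendsto_reducedSum_div (k + k) 0).congr fun N => ?_
  rw [kCount_succ_eq_reducedSum, add_zero, ← two_mul, pow_mul, Real.sq_sqrt (by positivity)]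
  push_cast
  rfl
end

section
/- Let d ≥ 1 be an integer and let C > 0, c > 0. Then there exist constants C′ > 0 and c′ > 0, depending only on d, C, c, such that for every probability measure μ on ℝ with μ([−2d, 2d]) = 1 satisfying ∫ (λ/(2d))^{2n} dμ(λ) ≤ C·exp(−c·n^{d/(d+2)}) for all integers n ≥ 0, and for every real ε with 0 < ε ≤ 1, one has μ((−∞, −2d + ε]) ≤ C′·exp(−c′·ε^{−d/2}). -/
open MeasureTheory

/-- Markov's inequality for even powers: the moment of order `2 * n` of a probability measure
supported in `[-R, R]` controls its mass near the left edge `-R`. -/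
lemma pow_mul_measureReal_Iic_le_integral_pow {μ : Measure ℝ} [IsProbabilityMeasure μ]
    {R ε : ℝ} (hR : 0 < R) (hεR : ε ≤ R) (hμ : μ (Set.Icc (-R) R) = 1) (n : ℕ) :
    (1 - ε / R) ^ (2 * n) * μ.real (Set.Iic (-R + ε)) ≤ ∫ x, (x / R) ^ (2 * n) ∂μ := by
  have hsupp : ∀ᵐ x ∂μ, x ∈ Set.Icc (-R) R :=
    (mem_ae_iff_prob_eq_one measurableSet_Icc).2 hμ
  have hint : Integrable (fun x : ℝ => (x / R) ^ (2 * n)) μ := by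
    refine Integrable.of_bound (by fun_prop) 1 ?_
    filter_upwards [hsupp] with x hx
    rw [norm_pow, norm_div, Real.norm_eq_abs, Real.norm_eq_abs, abs_of_pos hR]
    exact pow_le_one₀ (by positivity) ((div_le_one hR).2 (abs_le.2 hx))
  have hnonneg : 0 ≤ᵐ[μ] fun x : ℝ => (x / R) ^ (2 * n) :=
    Filter.Eventually.of_forall fun x => (even_two_mul n).pow_nonneg _
  have ht : 0 ≤ 1 - ε / R := sub_nonneg.2 ((div_le_one hR).2 hεR)
  refine le_trans ?_ (mul_meas_ge_le_integral_of_nonneg hnonneg hint ((1 - ε / R) ^ (2 * n)))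
  refine mul_le_mul_of_nonneg_left (measureReal_mono fun x hx => ?_) (by positivity)
  rw [Set.mem_ofPred_eq, ← (even_two_mul n).neg_pow (x / R)]
  refine pow_le_pow_left₀ ht ?_ _
  rw [← neg_div, le_div_iff₀ hR, sub_mul, div_mul_cancel₀ _ hR.ne']
  linarith [Set.mem_Iic.1 hx]

/-- For `0 ≤ t ≤ 1 / 2` one has `1 - t ≥ exp (-2 * t)`, in multiplicative form. -/
lemma one_le_one_sub_mul_exp_two_mul {t : ℝ} (h0 : 0 ≤ t) (h1 : t ≤ 1 / 2) :
    1 ≤ (1 - t) * Real.exp (2 * t) := by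
  nlinarith [Real.add_one_le_exp (2 * t)]

/-- **Lemma (upper Lifshitz tail from moment decay).**
For `d ≥ 1` and `C, c > 0` there are `C′, c′ > 0` such that every probability measure
`μ` supported in `[−2d, 2d]` with `∫ (λ/2d)^{2n} dμ ≤ C·exp(−c·n^{d/(d+2)})` for all
`n` satisfies `μ((−∞, −2d+ε]) ≤ C′·exp(−c′·ε^{−d/2})` for all `0 < ε ≤ 1`. -/
theorem umpteen_upper_tail_from_moments (d : ℕ) (hd : 1 ≤ d)
    (C c : ℝ) (hC : 0 < C) (hc : 0 < c) :
    ∃ C' > (0 : ℝ), ∃ c' > (0 : ℝ),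
      ∀ μ : Measure ℝ, IsProbabilityMeasure μ →
        μ (Set.Icc (-(2 * d : ℝ)) (2 * d)) = 1 →
        (∀ n : ℕ, ∫ x, (x / (2 * d)) ^ (2 * n) ∂μ
            ≤ C * Real.exp (-(c * (n : ℝ) ^ ((d : ℝ) / (d + 2))))) →
        ∀ ε : ℝ, 0 < ε → ε ≤ 1 →
          (μ (Set.Iic (-(2 * d : ℝ) + ε))).toReal
            ≤ C' * Real.exp (-(c' * ε ^ (-(d : ℝ) / 2))) := by
  have hdR : (1 : ℝ) ≤ d := by exact_mod_cast hd
  set p : ℝ := (d : ℝ) / (d + 2) with hp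
  have hp0 : 0 ≤ p := by positivity
  have hp1 : p ≤ 1 := (div_le_one (by positivity)).2 (by linarith)
  set q : ℝ := ((d : ℝ) + 2) / 2 with hq
  have hqp : q * p = d / 2 := by rw [hp, hq]; field_simp
  set a : ℝ := (c / 4) ^ q with ha
  have ha0 : 0 < a := by positivity
  have hap : c * a ^ p = 4 * a := by
    have h : a = (c / 4) ^ (q * p) * (c / 4) := by
      rw [hqp, ha, ← Real.rpow_add_one (by positivity)]
      congr 1
      rw [hq]
      ring
    rw [Real.rpow_mul (by positivity), ← ha] at h
    linarith
  refine ⟨C * Real.exp c, by positivity, 2 * a, by positivity, ?_⟩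
  intro μ _ hμ hmom ε hε hε1
  set E : ℝ := ε ^ (-(d : ℝ) / 2) with hE
  have hEq : (ε ^ (-q)) ^ p = E := by
    rw [← Real.rpow_mul hε.le, neg_mul, hqp, hE, neg_div]
  have hEε : ε ^ (-q) * ε = E := by
    rw [← Real.rpow_add_one hε.ne', hE, hq]
    congr 1
    ring
  set n : ℕ := ⌊a * ε ^ (-q)⌋₊ with hn
  have hnε : n * ε ≤ a * E := by
    rw [← hEε, ← mul_assoc]
    exact mul_le_mul_of_nonneg_right (Nat.floor_le (by positivity)) hε.le
  have hnp : 4 * a * E ≤ c * (n : ℝ) ^ p + c := by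
    have h1 : (a * ε ^ (-q)) ^ p ≤ ((n : ℝ) + 1) ^ p :=
      Real.rpow_le_rpow (by positivity) (Nat.lt_floor_add_one _).le hp0
    have h2 : ((n : ℝ) + 1) ^ p ≤ (n : ℝ) ^ p + 1 ^ p :=
      Real.rpow_add_le_add_rpow (by positivity) zero_le_one hp0 hp1
    rw [Real.mul_rpow ha0.le (by positivity), hEq] at h1
    rw [Real.one_rpow] at h2
    calc 4 * a * E = c * (a ^ p * E) := by rw [← hap]; ring
      _ ≤ c * ((n : ℝ) ^ p + 1) := mul_le_mul_of_nonneg_left (h1.trans h2) hc.le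
      _ = c * (n : ℝ) ^ p + c := by ring
  have hmarkov := (pow_mul_measureReal_Iic_le_integral_pow (ε := ε)
    (by positivity : (0 : ℝ) < 2 * d) (by linarith) hμ n).trans (hmom n)
  set t : ℝ := ε / (2 * d) with ht
  have ht0 : 0 ≤ t := by positivity
  have htε : t ≤ ε / 2 := div_le_div_of_nonneg_left hε.le two_pos (by linarith)
  have hpow : 1 ≤ (1 - t) ^ (2 * n) * Real.exp (4 * (n * t)) := by
    have h := one_le_pow₀ (n := 2 * n) (one_le_one_sub_mul_exp_two_mul ht0 (by linarith))
    have hexp : ((2 * n : ℕ) : ℝ) * (2 * t) = 4 * (n * t) := by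
      push_cast
      ring
    rwa [mul_pow, ← Real.exp_nat_mul, hexp] at h
  have hnt : 4 * (n * t) ≤ 2 * (a * E) := by
    have := mul_le_mul_of_nonneg_left htε (Nat.cast_nonneg (α := ℝ) n)
    linarith
  change μ.real (Set.Iic (-(2 * d : ℝ) + ε)) ≤ _
  calc μ.real (Set.Iic (-(2 * d : ℝ) + ε))
      ≤ ((1 - t) ^ (2 * n) * Real.exp (4 * (n * t))) * μ.real (Set.Iic (-(2 * d : ℝ) + ε)) :=
        le_mul_of_one_le_left measureReal_nonneg hpow
    _ = Real.exp (4 * (n * t)) * ((1 - t) ^ (2 * n) * μ.real (Set.Iic (-(2 * d : ℝ) + ε))) := by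
        ring
    _ ≤ Real.exp (4 * (n * t)) * (C * Real.exp (-(c * (n : ℝ) ^ p))) :=
        mul_le_mul_of_nonneg_left hmarkov (Real.exp_pos _).le
    _ = C * Real.exp (4 * (n * t) + -(c * (n : ℝ) ^ p)) := by
        rw [Real.exp_add]
        ring
    _ ≤ C * Real.exp (c + -(2 * a * E)) :=
        mul_le_mul_of_nonneg_left (Real.exp_le_exp.2 (by linarith)) hC.le
    _ = C * Real.exp c * Real.exp (-(2 * a * E)) := by
        rw [Real.exp_add]
        ring
end

section
/- Let d ≥ 1 be an integer and let C > 0, c > 0. Then there exist constants C′ > 0 and c′ > 0, depending only on d, C, c, such that for every probability measure μ on ℝ with μ([−2d, 2d]) = 1 which is symmetric (μ(B) = μ(−B) for every Borel set B ⊆ ℝ) and satisfies ∫ (λ/(2d))^{2n} dμ(λ) ≥ c·exp(−C·n^{d/(d+2)}·(log(n+2))^{2/(d+2)}) for all integers n ≥ 0, and for every real ε with 0 < ε ≤ 1, one has μ((−∞, −2d + ε]) ≥ c′·exp(−C′·ε^{−d/2}·log(1/ε + 2)). -/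
open MeasureTheory

/-- An even moment of a measure on `[-a, a]` is at most the mass near the two edges plus the
exponentially small contribution of the bulk. -/
lemma integral_div_pow_le_edge_mass_add_exp {a : ℝ} (ha : 0 < a) (μ : Measure ℝ)
    [IsProbabilityMeasure μ] (hsupp : μ (Set.Icc (-a) a) = 1) (n : ℕ) (ε : ℝ) :
    ∫ x, (x / a) ^ (2 * n) ∂μ ≤
      μ.real (Set.Iic (-a + ε)) + μ.real (Set.Ici (a - ε)) + Real.exp (-(2 * n * ε / a)) := by
  have hae : ∀ᵐ x ∂μ, x ∈ Set.Icc (-a) a :=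
    (mem_ae_iff_prob_eq_one measurableSet_Icc).2 hsupp
  have hI₁ : Integrable ((Set.Iic (-a + ε)).indicator (fun _ : ℝ => (1 : ℝ))) μ :=
    (integrable_const 1).indicator measurableSet_Iic
  have hI₂ : Integrable ((Set.Ici (a - ε)).indicator (fun _ : ℝ => (1 : ℝ))) μ :=
    (integrable_const 1).indicator measurableSet_Ici
  have hI₃ : Integrable (fun _ : ℝ => Real.exp (-(2 * n * ε / a))) μ := integrable_const _
  calc ∫ x, (x / a) ^ (2 * n) ∂μ
      ≤ ∫ x, ((Set.Iic (-a + ε)).indicator (fun _ => (1 : ℝ)) x +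
          (Set.Ici (a - ε)).indicator (fun _ => (1 : ℝ)) x +
          Real.exp (-(2 * n * ε / a))) ∂μ := by
        refine integral_mono_of_nonneg ?_ ((hI₁.add hI₂).add hI₃) ?_
        · exact Filter.Eventually.of_forall fun x => (even_two_mul n).pow_nonneg _
        filter_upwards [hae] with x hx
        have habs : |x| ≤ a := abs_le.2 hx
        have hpow : (x / a) ^ (2 * n) = (|x| / a) ^ (2 * n) := by
          rw [← (even_two_mul n).pow_abs (x / a), abs_div, abs_of_pos ha]
        have hle_one : (x / a) ^ (2 * n) ≤ 1 := by
          rw [hpow]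
          exact pow_le_one₀ (by positivity) ((div_le_one ha).2 habs)
        have hexp := Real.exp_pos (-(2 * n * ε / a))
        by_cases h₁ : x ∈ Set.Iic (-a + ε)
        · have h₂ : 0 ≤ (Set.Ici (a - ε)).indicator (fun _ => (1 : ℝ)) x :=
            Set.indicator_nonneg (fun _ _ => zero_le_one) x
          rw [Set.indicator_of_mem h₁]
          linarith
        by_cases h₂ : x ∈ Set.Ici (a - ε)
        · rw [Set.indicator_of_notMem h₁, Set.indicator_of_mem h₂]
          linarith
        rw [Set.indicator_of_notMem h₁, Set.indicator_of_notMem h₂, zero_add, zero_add, hpow]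
        rw [Set.mem_Iic, not_le] at h₁
        rw [Set.mem_Ici, not_le] at h₂
        have hbulk : |x| / a ≤ Real.exp (-(ε / a)) := by
          have hx' : |x| ≤ a - ε := abs_le.2 ⟨by linarith, h₂.le⟩
          calc |x| / a ≤ (a - ε) / a := by gcongr
            _ = -(ε / a) + 1 := by field_simp; ring
            _ ≤ Real.exp (-(ε / a)) := Real.add_one_le_exp _
        calc (|x| / a) ^ (2 * n) ≤ Real.exp (-(ε / a)) ^ (2 * n) := by gcongr
          _ = Real.exp (-(2 * n * ε / a)) := by
            rw [← Real.exp_nat_mul]; congr 1; push_cast; ring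
    _ = _ := by
        rw [integral_add (by exact hI₁.add hI₂) hI₃, integral_add hI₁ hI₂,
          integral_indicator_const _ measurableSet_Iic,
          integral_indicator_const _ measurableSet_Ici]
        simp

/-- Linear growth dominates `K^p (log K)^q` for `p + q = 1`, `q > 0`. -/
lemma exists_const_mul_rpow_mul_log_rpow_le {p q : ℝ} (hq : 0 < q) (hpq : p + q = 1)
    (B C D E : ℝ) (hE : 0 < E) :
    ∃ K : ℝ, 1 ≤ K ∧ D + C * ((2 * K) ^ p * (Real.log (4 * K) + B) ^ q) ≤ E * K := by
  have hlog : Filter.Tendsto (fun K : ℝ => (Real.log (4 * K) + B) / (2 * K))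
      Filter.atTop (nhds 0) := by
    have h₁ : Filter.Tendsto (fun K : ℝ => Real.log K / K) Filter.atTop (nhds 0) := by
      simpa using Real.tendsto_pow_log_div_mul_add_atTop 1 0 1 one_ne_zero
    have h₂ : Filter.Tendsto (fun K : ℝ => (Real.log 4 + B) / K) Filter.atTop (nhds 0) :=
      tendsto_const_nhds.div_atTop Filter.tendsto_id
    have h₃ := (h₁.add h₂).const_mul (1 / 2)
    simp only [add_zero, mul_zero] at h₃
    refine h₃.congr' ?_
    filter_upwards [Filter.eventually_gt_atTop 0] with K hK
    rw [Real.log_mul (by norm_num) hK.ne']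
    field_simp
    ring
  have hpow := (hlog.rpow_const (p := q) (Or.inr hq.le)).const_mul (2 * C)
  rw [Real.zero_rpow hq.ne', mul_zero] at hpow
  have hlarge : Filter.Tendsto (fun K : ℝ => Real.log (4 * K) + B) Filter.atTop Filter.atTop :=
    Filter.tendsto_atTop_add_const_right _ _
      (Real.tendsto_log_atTop.comp (Filter.tendsto_id.const_mul_atTop (by norm_num)))
  obtain ⟨K, hK₁, hKlog, hKsmall, hKD⟩ := ((Filter.eventually_ge_atTop (1 : ℝ)).and
    ((hlarge.eventually_ge_atTop 0).and
      ((hpow.eventually_le_const (half_pos hE)).and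
        (Filter.eventually_ge_atTop (2 * D / E))))).exists
  refine ⟨K, hK₁, ?_⟩
  have hK₀ : 0 < K := by linarith
  have hsplit : (2 * K) ^ p * (Real.log (4 * K) + B) ^ q =
      2 * K * ((Real.log (4 * K) + B) / (2 * K)) ^ q := by
    rw [Real.div_rpow hKlog (by positivity), show p = 1 - q by linarith,
      Real.rpow_sub (by positivity), Real.rpow_one]
    ring
  rw [hsplit]
  rw [div_le_iff₀ hE] at hKD
  nlinarith

/-- The moment order `n ≈ K ε^{-(d+2)/2} log (1/ε + 2)` balances the stretched-exponential rate
against the tail rate. -/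
lemma exists_nat_rate_bounds {d : ℝ} (hd : 0 < d) {K : ℝ} (hK : 1 ≤ K) {ε : ℝ} (hε : 0 < ε)
    (hε₁ : ε ≤ 1) :
    1 ≤ ε ^ (-d / 2) * Real.log (1 / ε + 2) ∧
    ∃ n : ℕ, K * (ε ^ (-d / 2) * Real.log (1 / ε + 2)) ≤ n * ε ∧
      (n : ℝ) ^ (d / (d + 2)) * Real.log ((n : ℝ) + 2) ^ (2 / (d + 2)) ≤
        (2 * K) ^ (d / (d + 2)) * (Real.log (4 * K) + (d + 4)) ^ (2 / (d + 2)) *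
          (ε ^ (-d / 2) * Real.log (1 / ε + 2)) := by
  set l := Real.log (1 / ε + 2) with hl
  have hinv : 1 ≤ 1 / ε := (one_le_div hε).2 hε₁
  have hl₁ : 1 ≤ l := by
    rw [hl, Real.le_log_iff_exp_le (by positivity)]
    linarith [Real.exp_one_lt_d9]
  have hpow₁ : ∀ r : ℝ, 0 ≤ r → 1 ≤ ε ^ (-r) := fun r hr =>
    Real.one_le_rpow_of_pos_of_le_one_of_nonpos hε hε₁ (by linarith)
  have hX : 1 ≤ ε ^ (-d / 2) * l := by
    rw [neg_div]
    exact one_le_mul_of_one_le_of_one_le (hpow₁ _ (by positivity)) hl₁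
  refine ⟨hX, ?_⟩
  set Y := ε ^ (-((d + 2) / 2)) with hY
  have hY₁ : 1 ≤ Y := hpow₁ _ (by positivity)
  have hYε : Y * ε = ε ^ (-d / 2) := by
    rw [hY]
    nth_rewrite 2 [← Real.rpow_one ε]
    rw [← Real.rpow_add hε]
    congr 1; ring
  have hYpow : Y ^ (d / (d + 2)) = ε ^ (-d / 2) := by
    rw [hY, ← Real.rpow_mul hε.le]
    congr 1; field_simp
  have hbase : 1 ≤ K * (Y * l) :=
    one_le_mul_of_one_le_of_one_le hK (one_le_mul_of_one_le_of_one_le hY₁ hl₁)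
  refine ⟨⌈K * (Y * l)⌉₊, ?_, ?_⟩
  · calc K * (ε ^ (-d / 2) * l) = K * (Y * l) * ε := by rw [← hYε]; ring
      _ ≤ _ := by gcongr; exact Nat.le_ceil _
  have hn : (⌈K * (Y * l)⌉₊ : ℝ) ≤ 2 * K * (Y * l) := by
    have := Nat.ceil_lt_add_one (a := K * (Y * l)) (by linarith)
    linarith
  set n : ℝ := (⌈K * (Y * l)⌉₊ : ℝ)
  have hn₀ : 0 ≤ n := Nat.cast_nonneg _
  have hlogK : 0 ≤ Real.log (4 * K) := Real.log_nonneg (by linarith)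
  have hlogn : Real.log (n + 2) ≤ (Real.log (4 * K) + (d + 4)) * l := by
    calc Real.log (n + 2) ≤ Real.log (4 * K * (Y * l)) :=
          Real.log_le_log (by linarith) (by linarith)
      _ = Real.log (4 * K) + ((d + 2) / 2 * Real.log (1 / ε) + Real.log l) := by
          rw [Real.log_mul (x := 4 * K) (by positivity) (by positivity),
            Real.log_mul (x := Y) (by positivity) (by positivity), hY, Real.log_rpow hε, one_div,
            Real.log_inv]
          ring
      _ ≤ Real.log (4 * K) + ((d + 2) / 2 * l + l) := by
          have h₁ : Real.log (1 / ε) ≤ l := Real.log_le_log (by positivity) (by linarith)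
          have h₂ : Real.log l ≤ l := Real.log_le_self (by linarith)
          gcongr
      _ ≤ _ := by nlinarith
  calc n ^ (d / (d + 2)) * Real.log (n + 2) ^ (2 / (d + 2))
      ≤ (2 * K * (Y * l)) ^ (d / (d + 2)) *
          ((Real.log (4 * K) + (d + 4)) * l) ^ (2 / (d + 2)) := by
        have h₀ : 0 ≤ Real.log (n + 2) := Real.log_nonneg (by linarith)
        gcongr
    _ = (2 * K) ^ (d / (d + 2)) * (Real.log (4 * K) + (d + 4)) ^ (2 / (d + 2)) *
          (Y ^ (d / (d + 2)) * (l ^ (d / (d + 2)) * l ^ (2 / (d + 2)))) := by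
        rw [Real.mul_rpow (x := 2 * K) (by positivity) (by positivity),
          Real.mul_rpow (x := Y) (by positivity) (by positivity),
          Real.mul_rpow (x := Real.log (4 * K) + (d + 4)) (by positivity) (by positivity)]
        ring
    _ = _ := by
        rw [hYpow, ← Real.rpow_add (by positivity), ← add_div, div_self (by positivity),
          Real.rpow_one]

/-- **Lemma (lower Lifshitz tail from moment lower bounds).**
For `d ≥ 1` and `C, c > 0` there are `C′, c′ > 0` such that every symmetric probability
measure `μ` supported in `[−2d, 2d]` with
`∫ (λ/2d)^{2n} dμ ≥ c·exp(−C·n^{d/(d+2)}·(log(n+2))^{2/(d+2)})` for all `n` satisfies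
`μ((−∞, −2d+ε]) ≥ c′·exp(−C′·ε^{−d/2}·log(1/ε + 2))` for all `0 < ε ≤ 1`. -/
theorem umpteen_lower_tail_from_moments (d : ℕ) (hd : 1 ≤ d)
    (C c : ℝ) (hC : 0 < C) (hc : 0 < c) :
    ∃ C' > (0 : ℝ), ∃ c' > (0 : ℝ),
      ∀ μ : Measure ℝ, IsProbabilityMeasure μ →
        μ (Set.Icc (-(2 * d : ℝ)) (2 * d)) = 1 →
        (∀ B : Set ℝ, MeasurableSet B → μ B = μ ((fun x => -x) ⁻¹' B)) →
        (∀ n : ℕ, c * Real.exp (-(C * (n : ℝ) ^ ((d : ℝ) / (d + 2)) *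
              Real.log ((n : ℝ) + 2) ^ ((2 : ℝ) / (d + 2))))
            ≤ ∫ x, (x / (2 * d)) ^ (2 * n) ∂μ) →
        ∀ ε : ℝ, 0 < ε → ε ≤ 1 →
          c' * Real.exp (-(C' * ε ^ (-(d : ℝ) / 2) * Real.log (1 / ε + 2)))
            ≤ (μ (Set.Iic (-(2 * d : ℝ) + ε))).toReal := by
  have hd₀ : (0 : ℝ) < d := by exact_mod_cast hd
  obtain ⟨K, hK₁, hK⟩ := exists_const_mul_rpow_mul_log_rpow_le
    (p := (d : ℝ) / (d + 2)) (q := 2 / ((d : ℝ) + 2)) (by positivity) (by field_simp)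
    ((d : ℝ) + 4) C |Real.log (2 / c)| (1 / d) (by positivity)
  refine ⟨1 / d * K, by positivity, c / 4, by positivity, ?_⟩
  intro μ hμ hsupp hsymm hmom ε hε hε₁
  obtain ⟨hX, n, hnε, hrate⟩ := exists_nat_rate_bounds hd₀ hK₁ hε hε₁
  have hn := hmom n
  have hedge := integral_div_pow_le_edge_mass_add_exp (a := 2 * (d : ℝ)) (by positivity)
    μ hsupp n ε
  have hreflect : μ.real (Set.Ici (2 * (d : ℝ) - ε)) = μ.real (Set.Iic (-(2 * d : ℝ) + ε)) := by
    rw [measureReal_def, measureReal_def, hsymm _ measurableSet_Ici]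
    congr 2
    ext x
    simp only [Set.mem_preimage, Set.mem_Ici, Set.mem_Iic]
    constructor <;> intro h <;> linarith
  rw [hreflect] at hedge
  rw [mul_assoc C] at hn
  rw [mul_assoc (1 / (d : ℝ) * K)]
  set X := ε ^ (-(d : ℝ) / 2) * Real.log (1 / ε + 2)
  set A := C * ((n : ℝ) ^ ((d : ℝ) / (d + 2)) * Real.log ((n : ℝ) + 2) ^ ((2 : ℝ) / (d + 2)))
  have hAX : |Real.log (2 / c)| + A ≤ 1 / d * K * X := by
    have h₁ := mul_le_mul_of_nonneg_left hrate hC.le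
    have h₂ := mul_le_mul_of_nonneg_right hK (zero_le_one.trans hX)
    have h₃ := le_mul_of_one_le_right (abs_nonneg (Real.log (2 / c))) hX
    linarith
  have hbulk : Real.exp (-(2 * n * ε / (2 * d))) ≤ c / 2 * Real.exp (-A) := by
    have hc₂ : c / 2 = Real.exp (-Real.log (2 / c)) := by
      rw [Real.exp_neg, Real.exp_log (by positivity), inv_div]
    rw [hc₂, ← Real.exp_add, Real.exp_le_exp]
    have h₁ : 1 / d * K * X ≤ 2 * n * ε / (2 * d) := by
      calc 1 / d * K * X = K * X / d := by ring
        _ ≤ n * ε / d := by gcongr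
        _ = _ := by field_simp
    linarith [le_abs_self (Real.log (2 / c))]
  have hexp : c / 4 * Real.exp (-(1 / d * K * X)) ≤ c / 4 * Real.exp (-A) := by
    gcongr
    linarith [abs_nonneg (Real.log (2 / c))]
  rw [← measureReal_def]
  linarith
end
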